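/- arXiv:1510.08158 — 2 statements merged into one kernel-verified Lean document; each statement's English description precedes it below -/
import Mathlib

section
/- (Overturning periodic waves must have a pressure sink.) Assume u² + v² ≠ 0 at every point of the free surface S. If the wave overturns, meaning that u takes both strictly positive and strictly negative values along S, then there exists a point of S at which ∂P/∂n > 0; in particular, the pressure P does not attain its minimum over the closure of Ω on the free surface S. -/
open Set

/-- Partial derivative in the horizontal direction. -/
noncomputable def pdX (f : ℝ × ℝ → ℝ) (p : ℝ × ℝ) : ℝ := fderiv ℝ f p (1, 0)

/-- Partial derivative in the vertical direction. -/
noncomputable def pdY (f : ℝ × ℝ → ℝ) (p : ℝ × ℝ) : ℝ := fderiv ℝ f p (0, 1)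

/-- A general (possibly overturning, possibly asymmetric) horizontally `2L`-periodic
steady water wave.  The free surface `S` is the non-self-intersecting `C²` curve
parametrized by `s ↦ (X s, Y s)`, lying above the bed `B = {y = -d}`, and the fluid
domain `Ω` is the open connected `2L`-periodic region whose boundary is `S ∪ B`.
The flow `(u, v)` with pressure `P` solves the steady Euler equations in `Ω`, is
tangent to `S`, has `P = Patm` on `S` and `v = 0` on `B`; `ψ` is a stream function,
vanishing on `S` and equal to the constant `m` on `B`. -/
structure GenPeriodicFlow (g Patm L d : ℝ) : Type where
  X : ℝ → ℝ
  Y : ℝ → ℝ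
  T : ℝ
  u : ℝ × ℝ → ℝ
  v : ℝ × ℝ → ℝ
  P : ℝ × ℝ → ℝ
  ψ : ℝ × ℝ → ℝ
  m : ℝ
  Ω : Set (ℝ × ℝ)
  T_pos : 0 < T
  X_smooth : ContDiff ℝ 2 X
  Y_smooth : ContDiff ℝ 2 Y
  regular : ∀ s, deriv X s ^ 2 + deriv Y s ^ 2 ≠ 0
  X_per : ∀ s, X (s + T) = X s + 2 * L
  Y_per : ∀ s, Y (s + T) = Y s
  S_above_bed : ∀ s, -d < Y s
  S_simple : ∀ s s', X s = X s' → Y s = Y s' → ∃ n : ℤ, s' = s + n * T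
  Ω_open : IsOpen Ω
  Ω_conn : IsConnected Ω
  Ω_per : ∀ p : ℝ × ℝ, p ∈ Ω ↔ (p.1 + 2 * L, p.2) ∈ Ω
  Ω_frontier : frontier Ω = (range fun s => (X s, Y s)) ∪ {p : ℝ × ℝ | p.2 = -d}
  u_smooth : ContDiff ℝ 1 u
  v_smooth : ContDiff ℝ 1 v
  P_smooth : ContDiff ℝ 2 P
  ψ_smooth : ContDiff ℝ 2 ψ
  u_periodic : ∀ x y, u (x + 2 * L, y) = u (x, y)
  v_periodic : ∀ x y, v (x + 2 * L, y) = v (x, y)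
  P_periodic : ∀ x y, P (x + 2 * L, y) = P (x, y)
  euler_x : ∀ p ∈ Ω, u p * pdX u p + v p * pdY u p = -pdX P p
  euler_y : ∀ p ∈ Ω, u p * pdX v p + v p * pdY v p = -(pdY P p) - g
  incompressible : ∀ p ∈ Ω, pdX u p + pdY v p = 0
  surface_pressure : ∀ s, P (X s, Y s) = Patm
  surface_tangency : ∀ s, u (X s, Y s) * deriv Y s = v (X s, Y s) * deriv X s
  bed_kinematic : ∀ x, v (x, -d) = 0
  psi_x : ∀ p ∈ closure Ω, pdX ψ p = -v p
  psi_y : ∀ p ∈ closure Ω, pdY ψ p = u p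
  psi_surface : ∀ s, ψ (X s, Y s) = 0
  psi_bed : ∀ x, ψ (x, -d) = m

namespace GenPeriodicFlow

variable {g Patm L d : ℝ}

/-- The vorticity `ω = v_x - u_y`. -/
noncomputable def vort (F : GenPeriodicFlow g Patm L d) (p : ℝ × ℝ) : ℝ :=
  pdX F.v p - pdY F.u p

/-- The free surface `S`, as a subset of the plane. -/
def surf (F : GenPeriodicFlow g Patm L d) : Set (ℝ × ℝ) :=
  range fun s => (F.X s, F.Y s)

/-- The maximal surface height `maxη = max_S y`. -/
noncomputable def maxη (F : GenPeriodicFlow g Patm L d) : ℝ := sSup (range F.Y)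

/-- The minimal surface height `minη = min_S y`. -/
noncomputable def minη (F : GenPeriodicFlow g Patm L d) : ℝ := sInf (range F.Y)

/-- The solution is nontrivial: `S` is not a horizontal line. -/
def Nontrivial' (F : GenPeriodicFlow g Patm L d) : Prop := ∃ s s', F.Y s ≠ F.Y s'

/-- `n` is an outward (non-fluid side) normal to `S` at the parameter `s`:
it is orthogonal to the tangent vector and points out of the fluid. -/
def IsOutwardNormalAt (F : GenPeriodicFlow g Patm L d) (n : ℝ × ℝ) (s : ℝ) : Prop :=
  n.1 * deriv F.X s + n.2 * deriv F.Y s = 0 ∧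
  ∃ t₀ > 0, ∀ t, 0 < t → t < t₀ → (F.X s + t * n.1, F.Y s + t * n.2) ∉ closure F.Ω

end GenPeriodicFlow

theorem Complex.exp_integral_logDeriv_mul {f f' : ℝ → ℂ} (hf : ∀ s, HasDerivAt f (f' s) s)
    (hf' : Continuous f') (h0 : ∀ s, f s ≠ 0) (s : ℝ) :
    Complex.exp (∫ t in (0 : ℝ)..s, f' t / f t) * f 0 = f s := by
  have hcf : Continuous f := continuous_iff_continuousAt.2 fun s => (hf s).continuousAt
  have hc : Continuous fun t => f' t / f t := hf'.div hcf h0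
  have hJ : ∀ s, HasDerivAt (fun s => ∫ t in (0 : ℝ)..s, f' t / f t) (f' s / f s) s :=
    fun s => hc.integral_hasStrictDerivAt 0 s |>.hasDerivAt
  have hD : ∀ s, HasDerivAt (fun s => Complex.exp (-∫ t in (0 : ℝ)..s, f' t / f t) * f s) 0 s := by
    intro s
    refine ((hJ s).neg.cexp.mul (hf s)).congr_deriv ?_
    simp only [Pi.neg_apply]
    linear_combination -Complex.exp (-∫ t in (0 : ℝ)..s, f' t / f t) *
      div_mul_cancel₀ (f' s) (h0 s)
  have hconst := is_const_of_deriv_eq_zero (fun s => (hD s).differentiableAt)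
    (fun s => (hD s).deriv) s 0
  simp only [intervalIntegral.integral_same, neg_zero, Complex.exp_zero, one_mul] at hconst
  rw [← hconst, ← mul_assoc, ← Complex.exp_add, add_neg_cancel, Complex.exp_zero, one_mul]

/-- The logarithmic integral of a continuous family of nonvanishing loops does not depend on the
parameter. -/
theorem Complex.integral_logDeriv_loop_eq {Z : Type*} [TopologicalSpace Z] [PreconnectedSpace Z]
    {f f' : Z → ℝ → ℂ} {T : ℝ} (hf : ∀ z s, HasDerivAt (f z) (f' z s) s)
    (hcf : Continuous (Function.uncurry f)) (hcf' : Continuous (Function.uncurry f'))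
    (h0 : ∀ z s, f z s ≠ 0) (hT : ∀ z, f z T = f z 0) (z w : Z) :
    ∫ t in (0 : ℝ)..T, f' z t / f z t = ∫ t in (0 : ℝ)..T, f' w t / f w t := by
  have hc : Continuous fun z => ∫ t in (0 : ℝ)..T, f' z t / f z t :=
    intervalIntegral.continuous_parametric_intervalIntegral_of_continuous'
      (f := fun z t => f' z t / f z t) (hcf'.div hcf fun p => h0 p.1 p.2) 0 T
  have hexp : ∀ z, ∃ n : ℤ, ∫ t in (0 : ℝ)..T, f' z t / f z t = n * (2 * Real.pi * Complex.I) := by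
    intro z
    rw [← Complex.exp_eq_one_iff]
    have h := Complex.exp_integral_logDeriv_mul (hf z)
      (hcf'.comp (Continuous.prodMk_right z)) (h0 z) T
    rw [hT z] at h
    exact mul_right_cancel₀ (h0 z 0) (h.trans (one_mul _).symm)
  choose n hn using hexp
  have hncont : Continuous n := by
    rw [Int.isClosedEmbedding_coe_real.isEmbedding.continuous_iff]
    have : ((Int.cast : ℤ → ℝ) ∘ n) =
        fun z => (∫ t in (0 : ℝ)..T, f' z t / f z t).im / (2 * Real.pi) := by
      funext z
      have := Real.pi_ne_zero
      simp [hn z]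
    rw [this]
    exact (Complex.continuous_im.comp hc).div_const _
  rw [hn, hn, PreconnectedSpace.constant ‹_› hncont]

/-- The tangent of an injective plane curve which is invariant under a translation has total
rotation zero over a period. -/
theorem Complex.integral_logDeriv_tangent_eq_zero {γ γ' γ'' : ℝ → ℂ} {T : ℝ} {c : ℂ} (hT : T ≠ 0)
    (h1 : ∀ s, HasDerivAt γ (γ' s) s) (h2 : ∀ s, HasDerivAt γ' (γ'' s) s)
    (hc : Continuous γ'') (h0 : ∀ s, γ' s ≠ 0) (hinj : Function.Injective γ)
    (hper : ∀ s, γ (s + T) = γ s + c) : ∫ t in (0 : ℝ)..T, γ'' t / γ' t = 0 := by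
  have hc1 : Continuous γ' := continuous_iff_continuousAt.2 fun s => (h2 s).continuousAt
  have hper' : ∀ s, γ' (s + T) = γ' s := fun s =>
    ((h1 (s + T)).comp_add_const s T).unique
      (((h1 s).add_const c).congr_of_eventuallyEq (.of_forall hper))
  have average : ∀ {h h' : ℝ → ℂ}, (∀ s, HasDerivAt h (h' s) s) → Continuous h' → ∀ ε s : ℝ,
      (ε : ℂ) * ∫ r in (0 : ℝ)..1, h' (s + ε * r) = h (s + ε) - h s := by
    intro h h' hh hh' ε s
    have := intervalIntegral.smul_integral_comp_add_mul (a := 0) (b := 1) h' ε s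
    rw [← Complex.real_smul, this, mul_zero, mul_one, add_zero]
    exact intervalIntegral.integral_eq_sub_of_hasDerivAt (fun t _ => hh t)
      (hh'.intervalIntegrable _ _)
  have key := Complex.integral_logDeriv_loop_eq (Z := ℝ) (T := T)
    (f := fun ε s => ∫ r in (0 : ℝ)..1, γ' (s + ε * r))
    (f' := fun ε s => ∫ r in (0 : ℝ)..1, γ'' (s + ε * r)) ?_ ?_ ?_ ?_ ?_ 0 T
  · have hconst : ∀ s, ∫ r in (0 : ℝ)..1, γ'' (s + T * r) = 0 := by
      intro s
      have := average h2 hc T s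
      rw [hper', sub_self, mul_eq_zero] at this
      exact this.resolve_left (by exact_mod_cast hT)
    simpa [hconst] using key
  · intro ε s
    rcases eq_or_ne ε 0 with rfl | hε
    · simpa using h2 s
    · have hε' : (ε : ℂ) ≠ 0 := by exact_mod_cast hε
      have e1 : (fun s => ∫ r in (0 : ℝ)..1, γ' (s + ε * r)) =
          fun s => (γ (s + ε) - γ s) / ε := by
        funext s
        rw [← average h1 hc1, mul_div_cancel_left₀ _ hε']
      have e2 : ∫ r in (0 : ℝ)..1, γ'' (s + ε * r) = (γ' (s + ε) - γ' s) / ε := by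
        rw [← average h2 hc, mul_div_cancel_left₀ _ hε']
      rw [e1, e2]
      exact (((h1 (s + ε)).comp_add_const s ε).sub (h1 s)).div_const _
  · exact intervalIntegral.continuous_parametric_intervalIntegral_of_continuous'
      (f := fun (p : ℝ × ℝ) r => γ' (p.2 + p.1 * r)) (by fun_prop) 0 1
  · exact intervalIntegral.continuous_parametric_intervalIntegral_of_continuous'
      (f := fun (p : ℝ × ℝ) r => γ'' (p.2 + p.1 * r)) (by fun_prop) 0 1
  · intro ε s hz
    rcases eq_or_ne ε 0 with rfl | hε
    · exact h0 s (by simpa using hz)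
    · have := average h1 hc1 ε s
      rw [hz, mul_zero, eq_comm, sub_eq_zero] at this
      have := hinj this
      exact hε (by linarith)
  · intro ε
    refine intervalIntegral.integral_congr fun r _ => ?_
    rw [zero_add, add_comm, hper']

theorem Complex.exists_continuous_periodic_angle {q q' : ℝ → ℂ} {T : ℝ}
    (hq : ∀ s, HasDerivAt q (q' s) s) (hq' : Continuous q') (h0 : ∀ s, q s ≠ 0)
    (hper : Function.Periodic q T) (hint : ∫ t in (0 : ℝ)..T, q' t / q t = 0) :
    ∃ θ : ℝ → ℝ, Continuous θ ∧ Function.Periodic θ T ∧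
      ∀ s, q s = ‖q s‖ * Complex.exp (θ s * Complex.I) := by
  have hcq : Continuous q := continuous_iff_continuousAt.2 fun s => (hq s).continuousAt
  have hc : Continuous fun t => q' t / q t := hq'.div hcq h0
  have hper' : Function.Periodic q' T := fun s =>
    ((hq (s + T)).comp_add_const s T).unique ((hq s).congr_of_eventuallyEq (.of_forall hper))
  have hpq : Function.Periodic (fun t => q' t / q t) T := fun s => by simp [hper s, hper' s]
  have hJ : Continuous fun s => ∫ t in (0 : ℝ)..s, q' t / q t :=
    
    continuous_iff_continuousAt.2 fun s => (hc.integral_hasStrictDerivAt 0 s).hasDerivAt.continuousAt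
  refine ⟨fun s => (q 0).arg + (∫ t in (0 : ℝ)..s, q' t / q t).im,
    continuous_const.add (Complex.continuous_im.comp hJ), fun s => ?_, fun s => ?_⟩
  · have h1 := intervalIntegral.integral_add_adjacent_intervals (μ := MeasureTheory.volume)
      (hc.intervalIntegrable 0 s) (hc.intervalIntegrable s (s + T))
    have h2 := hpq.intervalIntegral_add_eq s 0
    rw [zero_add, hint] at h2
    rw [h2, add_zero] at h1
    simp only [h1]
  · have h1 := Complex.exp_integral_logDeriv_mul hq hq' h0 s
    set J := ∫ t in (0 : ℝ)..s, q' t / q t with hJdef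
    have hn : ‖q s‖ = Real.exp J.re * ‖q 0‖ := by
      rw [← h1, norm_mul, Complex.norm_exp]
    have h2 : q s = Complex.exp (J.re + J.im * Complex.I) *
        (‖q 0‖ * Complex.exp ((q 0).arg * Complex.I)) := by
      rw [Complex.re_add_im, Complex.norm_mul_exp_arg_mul_I, h1]
    rw [hn, h2]
    push_cast
    rw [add_mul, Complex.exp_add, Complex.exp_add]
    ring

theorem exists_level_between_of_cos {a b : ℝ} (ha : 0 < Real.cos a) (hb : Real.cos b < 0) :
    ∃ α, Real.cos α = 0 ∧ (a < α ∧ α < b ∨ b < α ∧ α < a) := by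
  obtain ⟨α, hα, h⟩ := intermediate_value_uIcc (a := a) (b := b) Real.continuous_cos.continuousOn
    (show (0 : ℝ) ∈ uIcc (Real.cos a) (Real.cos b) from mem_uIcc.2 (.inr ⟨hb.le, ha.le⟩))
  have h1 : α ≠ a := by rintro rfl; linarith
  have h2 : α ≠ b := by rintro rfl; linarith
  refine ⟨α, h, ?_⟩
  rcases mem_uIcc.1 hα with h | h
  · exact .inl ⟨lt_of_le_of_ne h.1 h1.symm, lt_of_le_of_ne h.2 h2⟩
  · exact .inr ⟨lt_of_le_of_ne h.1 h2.symm, lt_of_le_of_ne h.2 h1⟩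

/-- An angle that can cross the vertical directions only counterclockwise and is periodic does not
cross them. -/
theorem not_cos_changes_sign_of_nonpos {θ r k A : ℝ → ℝ} {T : ℝ} (hT : 0 < T) (hθ : Continuous θ)
    (hper : Function.Periodic θ T) (hr : ∀ s, 0 < r s) (hA : ∀ s, A s = r s * Real.cos (θ s))
    (hA' : ∀ s, HasDerivAt A (k s * (r s * Real.sin (θ s))) s) (hk : ∀ s, k s ≤ 0)
    {s₁ s₂ : ℝ} (h₁ : 0 < Real.cos (θ s₁)) (h₂ : Real.cos (θ s₂) < 0) : False := by
  obtain ⟨α, hα, hlev⟩ := exists_level_between_of_cos h₁ h₂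
  obtain ⟨a₀, b, ha₀, hb⟩ : ∃ a b, θ a < α ∧ α < θ b := by
    rcases hlev with h | h
    exacts [⟨_, _, h⟩, ⟨_, _, h⟩]
  obtain ⟨N, hN⟩ := exists_nat_gt ((b - a₀) / T)
  obtain ⟨a, hba, ha⟩ : ∃ a, b < a ∧ θ a < α := by
    refine ⟨a₀ + N * T, ?_, ?_⟩
    · rw [div_lt_iff₀ hT] at hN; linarith
    · rwa [hper.nat_mul N a₀]
  -- the last time at which the level is reached
  obtain ⟨c, ⟨⟨hc, hcα⟩, hcmax⟩⟩ : ∃ c, IsGreatest (Icc b a ∩ {s | α ≤ θ s}) c :=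
    (isCompact_Icc.inter_right (isClosed_le continuous_const hθ)).exists_isGreatest
      ⟨b, ⟨le_rfl, hba.le⟩, hb.le⟩
  have hca : c < a := lt_of_le_of_ne hc.2 (by rintro rfl; exact absurd hcα (not_le.2 ha))
  have hafter : ∀ s, c < s → s ≤ a → θ s < α := fun s h h' => by
    by_contra! hcon
    exact absurd (hcmax ⟨⟨hc.1.trans h.le, h'⟩, hcon⟩) (not_le.2 h)
  have hθc : θ c = α := by
    refine le_antisymm ?_ hcα
    refine le_of_tendsto (hθ.continuousWithinAt (s := Ioi c) (x := c)) ?_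
    filter_upwards [Ioc_mem_nhdsGT hca] with s hs using (hafter s hs.1 hs.2).le
  obtain ⟨e, hce, he⟩ : ∃ e, c < e ∧ e ≤ a ∧ ∀ s ∈ Icc c e, α - 1 < θ s := by
    have : ∀ᶠ s in nhds c, α - 1 < θ s :=
      hθ.continuousAt.eventually (lt_mem_nhds (by rw [hθc]; linarith))
    obtain ⟨δ, hδ, h⟩ := Metric.eventually_nhds_iff.1 this
    refine ⟨min a (c + δ / 2), lt_min hca (by linarith), min_le_left _ _, fun s hs => h ?_⟩
    have := hs.2.trans (min_le_right _ _)
    rw [Real.dist_eq, abs_lt]; constructor <;> linarith [hs.1]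
  have hsq : Real.sin α * Real.sin α = 1 := by nlinarith [Real.sin_sq_add_cos_sq α]
  have hanti : AntitoneOn (fun s => Real.sin α * A s) (Icc c e) := by
    refine antitoneOn_of_hasDerivWithinAt_nonpos (convex_Icc c e)
      (f' := fun s => Real.sin α * (k s * (r s * Real.sin (θ s))))
      (fun s _ => ((hA' s).const_mul _).continuousAt.continuousWithinAt)
      (fun s _ => ((hA' s).const_mul _).hasDerivWithinAt) fun s hs => ?_
    rw [interior_Icc] at hs
    have hlow := he.2 s ⟨hs.1.le, hs.2.le⟩
    have hup := hafter s hs.1 (hs.2.le.trans he.1)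
    have hcos : 0 < Real.cos (α - θ s) :=
      Real.cos_pos_of_mem_Ioo ⟨by linarith [Real.pi_gt_three], by linarith [Real.pi_gt_three]⟩
    rw [Real.cos_sub, hα, zero_mul, zero_add] at hcos
    nlinarith [mul_pos (hr s) hcos, hk s]
  have hle := hanti ⟨le_rfl, hce.le⟩ ⟨hce.le, le_rfl⟩ hce.le
  have hlow := he.2 e ⟨hce.le, le_rfl⟩
  have hup := hafter e hce he.1
  have hsin : 0 < Real.sin (α - θ e) :=
    Real.sin_pos_of_pos_of_lt_pi (by linarith) (by linarith [Real.pi_gt_three])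
  rw [Real.sin_sub, hα, zero_mul, sub_zero] at hsin
  simp only [hA, hθc, hα, mul_zero] at hle
  nlinarith [mul_pos (hr e) hsin]

theorem not_cos_changes_sign {θ r k A : ℝ → ℝ} {T : ℝ} (hT : 0 < T) (hθ : Continuous θ)
    (hper : Function.Periodic θ T) (hr : ∀ s, 0 < r s) (hA : ∀ s, A s = r s * Real.cos (θ s))
    (hA' : ∀ s, HasDerivAt A (k s * (r s * Real.sin (θ s))) s)
    (hk : (∀ s, k s ≤ 0) ∨ ∀ s, 0 ≤ k s)
    {s₁ s₂ : ℝ} (h₁ : 0 < Real.cos (θ s₁)) (h₂ : Real.cos (θ s₂) < 0) : False := by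
  rcases hk with hk | hk
  · exact not_cos_changes_sign_of_nonpos hT hθ hper hr hA hA' hk h₁ h₂
  · refine not_cos_changes_sign_of_nonpos (θ := fun s => -θ s) (r := r) (k := fun s => -k s)
      (A := A) hT hθ.neg (fun s => by simp [hper s]) hr (fun s => by simp [hA s])
      (fun s => by simpa using hA' s) (fun s => by simpa using hk s) (s₁ := s₁) (s₂ := s₂)
      (by simpa using h₁) (by simpa using h₂)

/-- A curve in the plane invariant under a horizontal translation separates the points above it
from the points below it. -/
theorem Complex.not_above_and_below_of_isPreconnected {γ γ' : ℝ → ℂ} {T c : ℝ} (hc : 0 < c)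
    (h1 : ∀ s, HasDerivAt γ (γ' s) s) (hc' : Continuous γ') (hper : ∀ s, γ (s + T) = γ s + c)
    {Z : Set ℂ} (hZ : IsPreconnected Z) (hγZ : ∀ s, γ s ∉ Z) {a b : ℂ} (ha : a ∈ Z) (hb : b ∈ Z)
    (hγa : ∀ s, (γ s).im < a.im) (hγb : ∀ s, b.im < (γ s).im) : False := by
  have hpi : (Real.pi : ℂ) ≠ 0 := by exact_mod_cast Real.pi_ne_zero
  have hcc : (c : ℂ) ≠ 0 := by exact_mod_cast hc.ne'
  have hperZ : ∀ (n : ℤ) s, γ (s + n * T) = γ s + n * c := by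
    intro n
    induction n with
    | zero => simp
    | succ n ih =>
      intro s
      have := hper (s + ((n : ℤ) : ℝ) * T)
      rw [add_assoc, ← add_one_mul, ih s] at this
      push_cast at this ⊢
      rw [this]; ring
    | pred n ih =>
      intro s
      have := hper (s + (-n - 1 : ℝ) * T)
      rw [show s + (-n - 1 : ℝ) * T + T = s + (-n : ℤ) * T by push_cast; ring, ih s] at this
      push_cast at this ⊢
      linear_combination -this
  set κ : ℂ := 2 * Real.pi * Complex.I / c with hκ
  have hnorm : ∀ z : ℂ, ‖Complex.exp (κ * z)‖ = Real.exp (-(2 * Real.pi / c * z.im)) := by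
    intro z
    rw [Complex.norm_exp]
    congr 1
    have : κ * z = ((2 * Real.pi / c : ℝ) : ℂ) * (Complex.I * z) := by
      rw [hκ]; push_cast; ring
    rw [this, Complex.re_ofReal_mul]
    simp
  have hlt : ∀ z w : ℂ, z.im < w.im → ‖Complex.exp (κ * w)‖ < ‖Complex.exp (κ * z)‖ := by
    intro z w h
    rw [hnorm, hnorm, Real.exp_lt_exp, neg_lt_neg_iff]
    have : 0 < 2 * Real.pi / c := by positivity
    gcongr
  have hcγ : Continuous γ := continuous_iff_continuousAt.2 fun s => (h1 s).continuousAt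
  have hE : ∀ s, HasDerivAt (fun s => Complex.exp (κ * γ s))
      (Complex.exp (κ * γ s) * (κ * γ' s)) s := fun s => ((h1 s).const_mul κ).cexp
  have hloop : Complex.exp (κ * γ T) = Complex.exp (κ * γ 0) := by
    have : γ T = γ 0 + c := by simpa using hper 0
    rw [this, mul_add, Complex.exp_add, hκ, div_mul_cancel₀ _ hcc, Complex.exp_two_pi_mul_I,
      mul_one]
  -- the winding numbers at the two points agree
  have hW := by
    have := Subtype.preconnectedSpace hZ
    exact Complex.integral_logDeriv_loop_eq (Z := Z) (T := T)
      (f := fun z s => Complex.exp (κ * γ s) - Complex.exp (κ * z))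
      (f' := fun _ s => Complex.exp (κ * γ s) * (κ * γ' s))
      (fun z s => (hE s).sub_const _)
      (by fun_prop) (by fun_prop)
      (fun z s hz => by
        rw [sub_eq_zero, Complex.exp_eq_exp_iff_exists_int] at hz
        obtain ⟨n, hn⟩ := hz
        have h2 : (z : ℂ) = γ (s + (-n : ℤ) * T) := by
          rw [hperZ, hκ] at *
          field_simp at hn
          push_cast
          linear_combination -hn
        exact hγZ _ (h2 ▸ z.2))
      (fun z => by simp only [hloop]) ⟨a, ha⟩ ⟨b, hb⟩
  have : PreconnectedSpace (Icc (0 : ℝ) 1) := Subtype.preconnectedSpace isPreconnected_Icc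
  have ha' := Complex.integral_logDeriv_loop_eq (Z := Icc (0 : ℝ) 1) (T := T)
      (f := fun r s => Complex.exp (κ * γ s) - (r : ℝ) * Complex.exp (κ * a))
      (f' := fun _ s => Complex.exp (κ * γ s) * (κ * γ' s))
      (fun z s => (hE s).sub_const _)
      (by fun_prop) (by fun_prop)
      (fun r s hz => by
        have h2 := congrArg norm (sub_eq_zero.1 hz)
        rw [norm_mul, Complex.norm_real, Real.norm_of_nonneg r.2.1] at h2
        have := hlt _ _ (hγa s)
        nlinarith [r.2.1, r.2.2, norm_nonneg (Complex.exp (κ * a))])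
      (fun z => by simp only [hloop]) ⟨1, by simp⟩ ⟨0, by simp⟩
  have hb' := Complex.integral_logDeriv_loop_eq (Z := Icc (0 : ℝ) 1) (T := T)
      (f := fun r s => (r : ℝ) * Complex.exp (κ * γ s) - Complex.exp (κ * b))
      (f' := fun r s => (r : ℝ) * (Complex.exp (κ * γ s) * (κ * γ' s)))
      (fun z s => ((hE s).const_mul _).sub_const _)
      (by fun_prop) (by fun_prop)
      (fun r s hz => by
        have h2 := congrArg norm (sub_eq_zero.1 hz)
        rw [norm_mul, Complex.norm_real, Real.norm_of_nonneg r.2.1] at h2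
        have := hlt _ _ (hγb s)
        nlinarith [r.2.1, r.2.2, norm_nonneg (Complex.exp (κ * γ s))])
      (fun z => by simp only [hloop]) ⟨1, by simp⟩ ⟨0, by simp⟩
  have hone : ∫ t in (0 : ℝ)..T, Complex.exp (κ * γ t) * (κ * γ' t) / Complex.exp (κ * γ t) =
      2 * Real.pi * Complex.I := by
    simp_rw [mul_div_cancel_left₀ _ (Complex.exp_ne_zero _)]
    rw [intervalIntegral.integral_const_mul, intervalIntegral.integral_eq_sub_of_hasDerivAt
      (fun t _ => h1 t) (hc'.intervalIntegrable _ _)]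
    have : γ T = γ 0 + c := by simpa using hper 0
    rw [this, add_sub_cancel_left, hκ, div_mul_cancel₀ _ hcc]
  simp only [Complex.ofReal_one, one_mul, Complex.ofReal_zero, zero_mul, sub_zero, zero_div,
    intervalIntegral.integral_zero] at ha' hb' hW
  rw [hW, hb', hone] at ha'
  simp [Real.pi_ne_zero] at ha'

/-- The point at height `t` over the curve `(X, Y)`, measured along the (unnormalized) left
normal. -/
noncomputable def normalCollar (X Y : ℝ → ℝ) (p : ℝ × ℝ) : ℝ × ℝ :=
  (X p.1 - p.2 * deriv Y p.1, Y p.1 + p.2 * deriv X p.1)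

theorem normalCollar_zero (X Y : ℝ → ℝ) (s : ℝ) : normalCollar X Y (s, 0) = (X s, Y s) := by
  simp [normalCollar]

theorem hasStrictFDerivAt_normalCollar {X Y : ℝ → ℝ} (hX : ContDiff ℝ 2 X) (hY : ContDiff ℝ 2 Y)
    (hreg : ∀ s, deriv X s ^ 2 + deriv Y s ^ 2 ≠ 0) (s : ℝ) :
    ∃ D : (ℝ × ℝ) ≃L[ℝ] ℝ × ℝ, HasStrictFDerivAt (normalCollar X Y) (D : _ →L[ℝ] _) (s, 0) := by
  have hX' : ContDiff ℝ 1 (deriv X) := hX.deriv'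
  have hY' : ContDiff ℝ 1 (deriv Y) := hY.deriv'
  have hX1 : ContDiff ℝ 1 X := hX.of_le (by norm_num)
  have hY1 : ContDiff ℝ 1 Y := hY.of_le (by norm_num)
  have hΦ : ContDiff ℝ 1 (normalCollar X Y) := by unfold normalCollar; fun_prop
  have hstrict := hΦ.contDiffAt.hasStrictFDerivAt (x := (s, (0 : ℝ))) one_ne_zero
  set D := fderiv ℝ (normalCollar X Y) (s, 0) with hD
  have hd := hstrict.hasFDerivAt
  have e1 : D (1, 0) = (deriv X s, deriv Y s) := by
    have h := hd.comp_hasDerivAt (f := fun t : ℝ => (t, (0 : ℝ))) s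
      ((hasDerivAt_id s).prodMk (hasDerivAt_const s 0))
    refine h.unique ?_
    have : normalCollar X Y ∘ (fun t : ℝ => (t, (0 : ℝ))) = fun t => (X t, Y t) :=
      funext fun t => normalCollar_zero X Y t
    rw [this]
    exact (hX1.differentiable one_ne_zero s).hasDerivAt.prodMk
      (hY1.differentiable one_ne_zero s).hasDerivAt
  have e2 : D (0, 1) = (-deriv Y s, deriv X s) := by
    have h := hd.comp_hasDerivAt (f := fun t : ℝ => (s, t)) 0
      ((hasDerivAt_const 0 s).prodMk (hasDerivAt_id 0))
    refine h.unique ?_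
    have h1 := (((hasDerivAt_id (0 : ℝ)).mul_const (deriv Y s)).const_sub (X s)).prodMk
      (((hasDerivAt_id (0 : ℝ)).mul_const (deriv X s)).const_add (Y s))
    simp only [id_eq, one_mul] at h1
    exact h1
  have hinj : Function.Injective D.toLinearMap := by
    rw [← LinearMap.ker_eq_bot, LinearMap.ker_eq_bot']
    rintro ⟨a, b⟩ h
    have hab : ((a, b) : ℝ × ℝ) = a • (1, 0) + b • (0, 1) := by simp
    have h' : D (a, b) = 0 := h
    rw [hab, map_add, map_smul, map_smul, e1, e2] at h'
    simp only [Prod.smul_mk, Prod.mk_add_mk, smul_eq_mul, Prod.mk_eq_zero] at h'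
    obtain ⟨p, q⟩ := h'
    have ha : a * (deriv X s ^ 2 + deriv Y s ^ 2) = 0 := by
      linear_combination deriv X s * p + deriv Y s * q
    have hb : b * (deriv X s ^ 2 + deriv Y s ^ 2) = 0 := by
      linear_combination deriv X s * q - deriv Y s * p
    simp [(mul_eq_zero.1 ha).resolve_right (hreg s), (mul_eq_zero.1 hb).resolve_right (hreg s)]
  refine ⟨(LinearEquiv.ofInjectiveEndo D.toLinearMap hinj).toContinuousLinearEquiv, ?_⟩
  exact hstrict.congr_fderiv (ContinuousLinearMap.ext fun _ => rfl)

/-- Each point of a properly embedded curve `S` has a collar which meets `S` only along the curve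
itself and misses a given closed set disjoint from `S`. -/
theorem exists_normalCollar_ball {X Y : ℝ → ℝ} (hX : ContDiff ℝ 2 X) (hY : ContDiff ℝ 2 Y)
    (hreg : ∀ s, deriv X s ^ 2 + deriv Y s ^ 2 ≠ 0)
    (hemb : Topology.IsEmbedding fun s => (X s, Y s)) {B : Set (ℝ × ℝ)} (hB : IsClosed B)
    (hSB : ∀ s, (X s, Y s) ∉ B) (s₀ : ℝ) :
    ∃ δ > 0, normalCollar X Y '' Metric.ball (s₀, 0) δ ∈ nhds (X s₀, Y s₀) ∧
      ContinuousOn (normalCollar X Y) (Metric.ball (s₀, 0) δ) ∧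
      ∀ p ∈ Metric.ball (s₀, (0 : ℝ)) δ, p.2 ≠ 0 →
        normalCollar X Y p ∉ (range fun s => (X s, Y s)) ∪ B := by
  obtain ⟨D, hD⟩ := hasStrictFDerivAt_normalCollar hX hY hreg s₀
  have hcont : ContinuousAt (normalCollar X Y) (s₀, 0) := hD.continuousAt
  have hmap := hD.map_nhds_eq_of_equiv
  set e := hD.toOpenPartialHomeomorph _ with he
  have hmem : (s₀, (0 : ℝ)) ∈ e.source := hD.mem_toOpenPartialHomeomorph_source
  have hec : ∀ p, e p = normalCollar X Y p := fun p => rfl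
  have hsrc : e.source ∈ nhds (s₀, (0 : ℝ)) := e.open_source.mem_nhds hmem
  have hs : {s | (s, (0 : ℝ)) ∈ e.source} ∈ nhds s₀ :=
    (Continuous.prodMk_left (0 : ℝ)).continuousAt.preimage_mem_nhds hsrc
  rw [hemb.isInducing.nhds_eq_comap, Filter.mem_comap] at hs
  obtain ⟨V, hV, hVs⟩ := hs
  rw [← normalCollar_zero] at hV
  have hBc : Bᶜ ∈ nhds (normalCollar X Y (s₀, 0)) := by
    rw [normalCollar_zero]; exact hB.isOpen_compl.mem_nhds (hSB s₀)
  obtain ⟨δ, hδ, hball⟩ := Metric.mem_nhds_iff.1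
    (Filter.inter_mem hsrc (Filter.inter_mem (hcont.preimage_mem_nhds hV)
      (hcont.preimage_mem_nhds hBc)))
  refine ⟨δ, hδ, ?_, ?_, ?_⟩
  · rw [← normalCollar_zero, ← hmap]
    exact Filter.image_mem_map (Metric.ball_mem_nhds _ hδ)
  · exact e.continuousOn.mono fun p hp => (hball hp).1
  · rintro p hp hp2 (⟨s, hsp⟩ | hpB)
    · obtain ⟨h1, h2, -⟩ := hball hp
      have h3 : (s, (0 : ℝ)) ∈ e.source := hVs (by simpa [hsp] using h2)
      have h4 := e.injOn h1 h3 (by rw [hec, hec, normalCollar_zero]; exact hsp.symm)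
      exact hp2 (by rw [h4])
    · exact (hball hp).2.2 hpB

theorem IsPreconnected.subset_or_disjoint_closure {α : Type*} [TopologicalSpace α] {s t : Set α}
    (hs : IsPreconnected s) (ht : IsOpen t) (h : Disjoint s (frontier t)) :
    s ⊆ t ∨ Disjoint s (closure t) := by
  have hsub : s ⊆ t ∪ (closure t)ᶜ := fun x hx => by
    by_contra hcon
    simp only [mem_union, mem_compl_iff, not_or, not_not] at hcon
    exact h.notMem_of_mem_left hx (by rw [ht.frontier_eq]; exact ⟨hcon.2, hcon.1⟩)
  rcases hs.subset_or_subset ht isClosed_closure.isOpen_compl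
    (disjoint_compl_right.mono_left subset_closure) hsub with h | h
  · exact .inl h
  · exact .inr (disjoint_left.2 h)

/-- The points of the collar near the curve on the side `τ` lie in `Ω`. -/
def SideIn (X Y : ℝ → ℝ) (Ω : Set (ℝ × ℝ)) (τ s : ℝ) : Prop :=
  ∃ δ > 0, ∀ t, 0 < t → t < δ → normalCollar X Y (s, τ * t) ∈ Ω

/-- The points of the collar near the curve on the side `τ` lie outside `closure Ω`. -/
def SideOut (X Y : ℝ → ℝ) (Ω : Set (ℝ × ℝ)) (τ s : ℝ) : Prop :=
  ∃ δ > 0, ∀ t, 0 < t → t < δ → normalCollar X Y (s, τ * t) ∉ closure Ω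

theorem SideIn.not_sideOut {X Y : ℝ → ℝ} {Ω : Set (ℝ × ℝ)} {τ s : ℝ} (h : SideIn X Y Ω τ s) :
    ¬ SideOut X Y Ω τ s := by
  rintro ⟨δ', hδ', h'⟩
  obtain ⟨δ, hδ, h⟩ := h
  have hm : 0 < min δ δ' := lt_min hδ hδ'
  exact h' (min δ δ' / 2) (by linarith) (by linarith [min_le_right δ δ'])
    (subset_closure (h _ (by linarith) (by linarith [min_le_left δ δ'])))

section Sides

variable {X Y : ℝ → ℝ} {B Ω : Set (ℝ × ℝ)}

/-- Both sides of a small collar lie either in `Ω` or outside its closure. -/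
theorem exists_ball_sides (hX : ContDiff ℝ 2 X) (hY : ContDiff ℝ 2 Y)
    (hreg : ∀ s, deriv X s ^ 2 + deriv Y s ^ 2 ≠ 0)
    (hemb : Topology.IsEmbedding fun s => (X s, Y s)) (hB : IsClosed B)
    (hSB : ∀ s, (X s, Y s) ∉ B) (hΩ : IsOpen Ω)
    (hfr : frontier Ω = (range fun s => (X s, Y s)) ∪ B) (s₀ : ℝ) :
    ∃ δ > 0, normalCollar X Y '' Metric.ball (s₀, 0) δ ∈ nhds (X s₀, Y s₀) ∧
      ∀ τ : ℝ, |τ| = 1 →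
        ((∀ s ∈ Metric.ball s₀ δ, SideIn X Y Ω τ s) ∧
          ∀ p ∈ Metric.ball (s₀, (0 : ℝ)) δ, 0 < τ * p.2 → normalCollar X Y p ∈ Ω) ∨
        ((∀ s ∈ Metric.ball s₀ δ, SideOut X Y Ω τ s) ∧
          ∀ p ∈ Metric.ball (s₀, (0 : ℝ)) δ, 0 < τ * p.2 → normalCollar X Y p ∉ closure Ω) := by
  obtain ⟨δ, hδ, hnhds, hcont, hdisj⟩ := exists_normalCollar_ball hX hY hreg hemb hB hSB s₀
  refine ⟨δ, hδ, hnhds, fun τ hτ => ?_⟩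
  have hτ0 : τ ≠ 0 := by rintro rfl; simp at hτ
  have hττ : 0 < τ * τ := mul_self_pos.2 hτ0
  have hball : ∀ s ∈ Metric.ball s₀ δ, ∀ t, 0 < t → t < δ →
      (s, τ * t) ∈ Metric.ball (s₀, (0 : ℝ)) δ ∧ 0 < τ * (τ * t) := by
    intro s hs t ht htδ
    rw [← ball_prod_same]
    refine ⟨⟨hs, ?_⟩, by rw [← mul_assoc]; positivity⟩
    simpa [abs_mul, hτ, abs_of_pos ht] using htδ
  have hconv : Convex ℝ (Metric.ball (s₀, (0 : ℝ)) δ ∩ {p | 0 < τ * p.2}) := by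
    refine (convex_ball _ _).inter ?_
    have : IsLinearMap ℝ fun p : ℝ × ℝ => τ * p.2 :=
      ⟨fun x y => by simp [mul_add], fun c x => by simp; ring⟩
    exact convex_halfSpace_gt this 0
  have hpre := hconv.isPreconnected.image _ (hcont.mono inter_subset_left)
  have hd : Disjoint (normalCollar X Y '' (Metric.ball (s₀, (0 : ℝ)) δ ∩ {p | 0 < τ * p.2}))
      (frontier Ω) := by
    rw [disjoint_left, hfr]
    rintro _ ⟨p, ⟨hp, hp2⟩, rfl⟩
    refine hdisj p hp fun h0 => ?_
    simp [h0] at hp2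
  rcases hpre.subset_or_disjoint_closure hΩ hd with h | h
  · have h' : ∀ p ∈ Metric.ball (s₀, (0 : ℝ)) δ, 0 < τ * p.2 → normalCollar X Y p ∈ Ω :=
      fun p hp hp2 => h ⟨p, ⟨hp, hp2⟩, rfl⟩
    exact .inl ⟨fun s hs => ⟨δ, hδ, fun t h1 h2 =>
      h' _ (hball s hs t h1 h2).1 (hball s hs t h1 h2).2⟩, h'⟩
  · have h' : ∀ p ∈ Metric.ball (s₀, (0 : ℝ)) δ, 0 < τ * p.2 → normalCollar X Y p ∉ closure Ω :=
      fun p hp hp2 => disjoint_left.1 h ⟨p, ⟨hp, hp2⟩, rfl⟩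
    exact .inr ⟨fun s hs => ⟨δ, hδ, fun t h1 h2 =>
      h' _ (hball s hs t h1 h2).1 (hball s hs t h1 h2).2⟩, h'⟩

theorem forall_sideIn_or_forall_sideOut (hX : ContDiff ℝ 2 X) (hY : ContDiff ℝ 2 Y)
    (hreg : ∀ s, deriv X s ^ 2 + deriv Y s ^ 2 ≠ 0)
    (hemb : Topology.IsEmbedding fun s => (X s, Y s)) (hB : IsClosed B)
    (hSB : ∀ s, (X s, Y s) ∉ B) (hΩ : IsOpen Ω)
    (hfr : frontier Ω = (range fun s => (X s, Y s)) ∪ B) {τ : ℝ} (hτ : |τ| = 1) :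
    (∀ s, SideIn X Y Ω τ s) ∨ ∀ s, SideOut X Y Ω τ s := by
  have hloc : ∀ s₀, (∀ᶠ s in nhds s₀, SideIn X Y Ω τ s) ∨ ∀ᶠ s in nhds s₀, SideOut X Y Ω τ s := by
    intro s₀
    obtain ⟨δ, hδ, -, h⟩ := exists_ball_sides hX hY hreg hemb hB hSB hΩ hfr s₀
    have hnh : Metric.ball s₀ δ ∈ nhds s₀ := Metric.ball_mem_nhds _ hδ
    exact (h τ hτ).imp (fun h => Filter.mem_of_superset hnh h.1)
      fun h => Filter.mem_of_superset hnh h.1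
  have hopen : IsOpen {s | SideIn X Y Ω τ s} := isOpen_iff_mem_nhds.2 fun s hs =>
    (hloc s).resolve_right fun h => SideIn.not_sideOut hs h.self_of_nhds
  have hout : ∀ s, ¬ SideIn X Y Ω τ s → ∀ᶠ s in nhds s, SideOut X Y Ω τ s := fun s hs =>
    (hloc s).resolve_left fun h => hs h.self_of_nhds
  have hclosed : IsClosed {s | SideIn X Y Ω τ s} := by
    refine ⟨isOpen_iff_mem_nhds.2 fun s hs => ?_⟩
    filter_upwards [hout s hs] with s' hs' h using SideIn.not_sideOut h hs'
  rcases isClopen_iff.1 ⟨hclosed, hopen⟩ with h | h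
  · exact .inr fun s => (hout s fun hs => (h ▸ hs : s ∈ (∅ : Set ℝ))).self_of_nhds
  · exact .inl fun s => (h ▸ mem_univ s : s ∈ {s | SideIn X Y Ω τ s})

theorem not_sideOut_both (hX : ContDiff ℝ 2 X) (hY : ContDiff ℝ 2 Y)
    (hreg : ∀ s, deriv X s ^ 2 + deriv Y s ^ 2 ≠ 0)
    (hemb : Topology.IsEmbedding fun s => (X s, Y s)) (hB : IsClosed B)
    (hSB : ∀ s, (X s, Y s) ∉ B) (hΩ : IsOpen Ω)
    (hfr : frontier Ω = (range fun s => (X s, Y s)) ∪ B) (s₀ : ℝ)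
    (h1 : SideOut X Y Ω 1 s₀) (h2 : SideOut X Y Ω (-1) s₀) : False := by
  obtain ⟨δ, hδ, hnhds, h⟩ := exists_ball_sides hX hY hreg hemb hB hSB hΩ hfr s₀
  have hs₀ : s₀ ∈ Metric.ball s₀ δ := Metric.mem_ball_self hδ
  have hp := (h 1 (by simp)).resolve_left fun h => (h.1 s₀ hs₀).not_sideOut h1
  have hm := (h (-1) (by simp)).resolve_left fun h => (h.1 s₀ hs₀).not_sideOut h2
  have hfrS : ∀ s, (X s, Y s) ∈ frontier Ω := fun s => by rw [hfr]; exact .inl ⟨s, rfl⟩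
  obtain ⟨q, ⟨p, hpb, rfl⟩, hq⟩ := mem_closure_iff_nhds.1 (hfrS s₀).1 _ hnhds
  rcases lt_trichotomy p.2 0 with h0 | h0 | h0
  · exact hm.2 p hpb (by linarith) (subset_closure hq)
  · have := hfrS p.1
    rw [← normalCollar_zero, ← h0, hΩ.frontier_eq] at this
    exact this.2 hq
  · exact hp.2 p hpb (by linarith) (subset_closure hq)

theorem isOpen_union_range_of_sideIn_both (hX : ContDiff ℝ 2 X) (hY : ContDiff ℝ 2 Y)
    (hreg : ∀ s, deriv X s ^ 2 + deriv Y s ^ 2 ≠ 0)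
    (hemb : Topology.IsEmbedding fun s => (X s, Y s)) (hB : IsClosed B)
    (hSB : ∀ s, (X s, Y s) ∉ B) (hΩ : IsOpen Ω)
    (hfr : frontier Ω = (range fun s => (X s, Y s)) ∪ B)
    (h1 : ∀ s, SideIn X Y Ω 1 s) (h2 : ∀ s, SideIn X Y Ω (-1) s) :
    IsOpen (Ω ∪ range fun s => (X s, Y s)) := by
  refine isOpen_iff_mem_nhds.2 ?_
  rintro q (hq | ⟨s₀, rfl⟩)
  · exact Filter.mem_of_superset (hΩ.mem_nhds hq) subset_union_left
  · obtain ⟨δ, hδ, hnhds, h⟩ := exists_ball_sides hX hY hreg hemb hB hSB hΩ hfr s₀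
    have hs₀ : s₀ ∈ Metric.ball s₀ δ := Metric.mem_ball_self hδ
    have hp := (h 1 (by simp)).resolve_right fun h => (h1 s₀).not_sideOut (h.1 s₀ hs₀)
    have hm := (h (-1) (by simp)).resolve_right fun h => (h2 s₀).not_sideOut (h.1 s₀ hs₀)
    refine Filter.mem_of_superset hnhds ?_
    rintro _ ⟨p, hpb, rfl⟩
    rcases lt_trichotomy p.2 0 with h0 | h0 | h0
    · exact .inl (hm.2 p hpb (by linarith))
    · exact .inr ⟨p.1, by simp [normalCollar, h0]⟩
    · exact .inl (hp.2 p hpb (by linarith))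

/-- A connected open set bounded by a horizontally periodic curve and a horizontal line below it
does not lie on both sides of the curve. -/
theorem not_sideIn_both {T c d : ℝ} (hT : 0 < T) (hc : 0 < c)
    (hX : ContDiff ℝ 2 X) (hY : ContDiff ℝ 2 Y)
    (hreg : ∀ s, deriv X s ^ 2 + deriv Y s ^ 2 ≠ 0)
    (hemb : Topology.IsEmbedding fun s => (X s, Y s))
    (hXper : ∀ s, X (s + T) = X s + c) (hYper : Function.Periodic Y T)
    (hd : ∀ s, -d < Y s) (hΩ : IsOpen Ω) (hconn : IsPreconnected Ω)
    (hfr : frontier Ω = (range fun s => (X s, Y s)) ∪ {p | p.2 = -d})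
    (h1 : ∀ s, SideIn X Y Ω 1 s) (h2 : ∀ s, SideIn X Y Ω (-1) s) : False := by
  set S := range fun s => (X s, Y s) with hSdef
  have hopen := isOpen_union_range_of_sideIn_both hX hY hreg hemb
    (isClosed_eq continuous_snd continuous_const) (fun s h => (hd s).ne' h) hΩ hfr h1 h2
  have hSfr : S ⊆ frontier Ω := hfr ▸ subset_union_left
  have hhalf : {p : ℝ × ℝ | -d < p.2} ⊆ Ω ∪ S := by
    have hpre : IsPreconnected {p : ℝ × ℝ | -d < p.2} :=
      (convex_halfSpace_gt (f := fun p : ℝ × ℝ => p.2)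
        ⟨fun _ _ => rfl, fun _ _ => rfl⟩ (-d)).isPreconnected
    refine hpre.subset_left_of_subset_union hopen isClosed_closure.isOpen_compl
      (disjoint_compl_right.mono_left (union_subset subset_closure
        fun p hp => (hSfr hp).1)) (fun p hp => ?_)
      ⟨_, hd 0, .inr ⟨0, rfl⟩⟩
    by_contra hcon
    simp only [mem_union, mem_compl_iff, not_or, not_not] at hcon
    have : p ∈ frontier Ω := by rw [hΩ.frontier_eq]; exact ⟨hcon.2, hcon.1.1⟩
    rw [hfr] at this
    rcases this with h | h
    · exact hcon.1.2 h
    · exact (ne_of_gt hp) h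
  have hYc : Continuous Y := hY.continuous
  obtain ⟨yM, hM⟩ : ∃ s₁, ∀ s, Y s ≤ Y s₁ := by
    obtain ⟨s₁, -, h⟩ := isCompact_Icc.exists_isMaxOn (nonempty_Icc.2 hT.le) hYc.continuousOn
    refine ⟨s₁, fun s => ?_⟩
    obtain ⟨t, ht, hst⟩ := hYper.exists_mem_Ico₀ hT s
    exact hst ▸ h ⟨ht.1, ht.2.le⟩
  obtain ⟨ym, hm⟩ : ∃ s₁, ∀ s, Y s₁ ≤ Y s := by
    obtain ⟨s₁, -, h⟩ := isCompact_Icc.exists_isMinOn (nonempty_Icc.2 hT.le) hYc.continuousOn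
    refine ⟨s₁, fun s => ?_⟩
    obtain ⟨t, ht, hst⟩ := hYper.exists_mem_Ico₀ hT s
    exact hst ▸ h ⟨ht.1, ht.2.le⟩
  obtain ⟨y, hdy, hy⟩ := exists_between (hd ym)
  have mem_of_ne : ∀ x : ℝ, -d < x → (∀ s, Y s ≠ x) → ((0 : ℝ), x) ∈ Ω := fun x hx hne => by
    rcases hhalf (show ((0 : ℝ), x) ∈ {p : ℝ × ℝ | -d < p.2} from hx) with h | ⟨s, hs⟩
    · exact h
    · exact absurd (congrArg Prod.snd hs) (hne s)
  have hcX : Continuous (deriv X) := hX.continuous_deriv (by norm_num)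
  have hcY : Continuous (deriv Y) := hY.continuous_deriv (by norm_num)
  have htoC : ∀ p : ℝ × ℝ, Complex.equivRealProdCLM.symm p = p.1 + p.2 * Complex.I := fun p => by
    apply Complex.ext <;> simp
  refine Complex.not_above_and_below_of_isPreconnected (γ := fun s => X s + Y s * Complex.I)
    (γ' := fun s => deriv X s + deriv Y s * Complex.I) (T := T) hc
    (fun s => ((hX.differentiable two_ne_zero s).hasDerivAt.ofReal_comp).add
      ((hY.differentiable two_ne_zero s).hasDerivAt.ofReal_comp.mul_const _))
    (by fun_prop) (fun s => by rw [hXper, hYper]; push_cast; ring)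
    (hconn.image _ Complex.equivRealProdCLM.symm.continuous.continuousOn) ?_
    (mem_image_of_mem _ (mem_of_ne (Y yM + 1) (by linarith [hd yM])
      fun s => ((hM s).trans_lt (lt_add_one _)).ne))
    (mem_image_of_mem _ (mem_of_ne y hdy fun s => (hy.trans_le (hm s)).ne')) ?_ ?_
  · rintro s ⟨p, hp, hps⟩
    rw [← htoC (X s, Y s)] at hps
    obtain rfl := Complex.equivRealProdCLM.symm.injective hps
    have := hSfr ⟨s, rfl⟩
    rw [hΩ.frontier_eq] at this
    exact this.2 hp
  · intro s
    simpa [htoC] using (hM s).trans_lt (lt_add_one (Y yM))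
  · intro s
    simpa [htoC] using hy.trans_le (hm s)

end Sides

theorem isEmbedding_of_add_period {X Y : ℝ → ℝ} {T c : ℝ} (hT : 0 < T) (hc : 0 < c)
    (hX : Continuous X) (hY : Continuous Y) (hper : ∀ s, X (s + T) = X s + c)
    (hinj : Function.Injective fun s => (X s, Y s)) :
    Topology.IsEmbedding fun s => (X s, Y s) := by
  have hcont : Continuous fun s => (X s, Y s) := hX.prodMk hY
  have hp : Function.Periodic (fun s => X s - c / T * s) T := fun s => by
    simp only [hper]; field_simp; ring
  obtain ⟨M, hM⟩ : ∃ M, ∀ s, |X s - c / T * s| ≤ M := by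
    obtain ⟨M, hM⟩ := isCompact_Icc.exists_bound_of_continuousOn (s := Icc 0 T)
      (f := fun s => X s - c / T * s) (by fun_prop)
    refine ⟨M, fun s => ?_⟩
    obtain ⟨t, ht, hst⟩ := hp.exists_mem_Ico₀ hT s
    exact hst ▸ hM t ⟨ht.1, ht.2.le⟩
  refine (Topology.IsClosedEmbedding.of_continuous_injective_isClosedMap hcont hinj
    (IsProperMap.isClosedMap ?_)).isEmbedding
  rw [isProperMap_iff_tendsto_cocompact]
  refine ⟨hcont, ?_⟩
  rw [← Metric.cobounded_eq_cocompact, ← Metric.cobounded_eq_cocompact,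
    ← tendsto_norm_atTop_iff_cobounded]
  have hlin : Filter.Tendsto (fun s : ℝ => c / T * ‖s‖ - M) (Bornology.cobounded ℝ)
      Filter.atTop :=
    Filter.tendsto_atTop_add_const_right _ _
      (tendsto_norm_cobounded_atTop.const_mul_atTop (by positivity))
  refine Filter.tendsto_atTop_mono (fun s => ?_) hlin
  have h1 : |X s| ≤ ‖(X s, Y s)‖ := norm_fst_le (X s, Y s)
  have h2 : |c / T * s| ≤ |X s| + |X s - c / T * s| := by
    have := abs_sub (X s) (X s - c / T * s)
    rwa [sub_sub_cancel] at this
  rw [abs_mul, abs_of_pos (by positivity : 0 < c / T)] at h2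
  rw [Real.norm_eq_abs]
  linarith [hM s]

/-- Along a nowhere stagnant closed streamline on which the horizontal acceleration is `c` times
`dY / λ`, with `c` of constant sign, the horizontal velocity has constant sign. -/
theorem not_horizontal_velocity_changes_sign {X Y u v l k : ℝ → ℝ} {T c : ℝ} (hT : 0 < T)
    (hX : ContDiff ℝ 2 X) (hY : ContDiff ℝ 2 Y)
    (hreg : ∀ s, deriv X s ^ 2 + deriv Y s ^ 2 ≠ 0)
    (hXper : ∀ s, X (s + T) = X s + c) (hYper : Function.Periodic Y T)
    (hinj : Function.Injective fun s => (X s, Y s)) (hl : Continuous l) (hl0 : ∀ s, l s ≠ 0)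
    (hu : ∀ s, u s = l s * deriv X s) (hv : ∀ s, v s = l s * deriv Y s)
    (hu' : ∀ s, HasDerivAt u (k s * v s) s) (hk : (∀ s, k s ≤ 0) ∨ ∀ s, 0 ≤ k s)
    {s₁ s₂ : ℝ} (h₁ : 0 < u s₁) (h₂ : u s₂ < 0) : False := by
  have hX' : ContDiff ℝ 1 (deriv X) := hX.deriv'
  have hY' : ContDiff ℝ 1 (deriv Y) := hY.deriv'
  set γ' : ℝ → ℂ := fun s => deriv X s + deriv Y s * Complex.I with hγ'
  set γ'' : ℝ → ℂ := fun s => deriv (deriv X) s + deriv (deriv Y) s * Complex.I with hγ''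
  have d1 : ∀ s, HasDerivAt (fun s => X s + Y s * Complex.I : ℝ → ℂ) (γ' s) s := fun s =>
    ((hX.differentiable two_ne_zero s).hasDerivAt.ofReal_comp).add
      ((hY.differentiable two_ne_zero s).hasDerivAt.ofReal_comp.mul_const _)
  have d2 : ∀ s, HasDerivAt γ' (γ'' s) s := fun s =>
    ((hX'.differentiable one_ne_zero s).hasDerivAt.ofReal_comp).add
      ((hY'.differentiable one_ne_zero s).hasDerivAt.ofReal_comp.mul_const _)
  have hcont : Continuous γ'' := by
    have h1 : Continuous (deriv (deriv X)) := hX'.continuous_deriv le_rfl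
    have h2 : Continuous (deriv (deriv Y)) := hY'.continuous_deriv le_rfl
    fun_prop
  have hne : ∀ s, γ' s ≠ 0 := fun s h => hreg s (by
    have h1 := congrArg Complex.re h
    have h2 := congrArg Complex.im h
    simp [hγ'] at h1 h2
    simp [h1, h2])
  have hinjC : Function.Injective (fun s => X s + Y s * Complex.I : ℝ → ℂ) := fun a b h => by
    have h1 := congrArg Complex.re h
    have h2 := congrArg Complex.im h
    simp at h1 h2
    exact hinj (Prod.ext h1 h2)
  have hperC : ∀ s, (X (s + T) + Y (s + T) * Complex.I : ℂ) = X s + Y s * Complex.I + c := by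
    intro s; rw [hXper, hYper]; push_cast; ring
  have hper' : Function.Periodic γ' T := fun s =>
    ((d1 (s + T)).comp_add_const s T).unique
      (((d1 s).add_const _).congr_of_eventuallyEq (.of_forall hperC))
  have hint := Complex.integral_logDeriv_tangent_eq_zero hT.ne' d1 d2 hcont hne hinjC hperC
  obtain ⟨θ, hθ, hθper, hθγ⟩ :=
    Complex.exists_continuous_periodic_angle d2 hcont hne hper' hint
  have hcos : ∀ s, deriv X s = ‖γ' s‖ * Real.cos (θ s) := fun s => by
    have := congrArg Complex.re (hθγ s)
    rw [Complex.re_ofReal_mul, Complex.exp_ofReal_mul_I_re] at this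
    simpa [hγ'] using this
  have hsin : ∀ s, deriv Y s = ‖γ' s‖ * Real.sin (θ s) := fun s => by
    have := congrArg Complex.im (hθγ s)
    rw [Complex.im_ofReal_mul, Complex.exp_ofReal_mul_I_im] at this
    simpa [hγ'] using this
  have hpos : ∀ s, 0 < ‖γ' s‖ := fun s => norm_pos_iff.2 (hne s)
  have hsign : (∀ s, 0 < l s) ∨ ∀ s, l s < 0 := by
    by_contra! hcon
    obtain ⟨⟨a, ha⟩, ⟨b, hb⟩⟩ := hcon
    obtain ⟨s, hs⟩ := mem_range_of_exists_le_of_exists_ge hl ⟨a, ha⟩ ⟨b, hb⟩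
    exact hl0 s hs
  have hu₁ := hu s₁
  have hu₂ := hu s₂
  rw [hcos] at hu₁ hu₂
  rw [hu₁] at h₁
  rw [hu₂] at h₂
  rcases hsign with hs | hs
  · refine not_cos_changes_sign (r := fun s => l s * ‖γ' s‖) (k := k) (A := u) hT hθ hθper
      (fun s => mul_pos (hs s) (hpos s)) (fun s => by rw [hu, hcos]; ring)
      (fun s => (hu' s).congr_deriv (by rw [hv, hsin]; ring)) hk (s₁ := s₁) (s₂ := s₂) ?_ ?_
    · rw [← mul_assoc] at h₁
      exact (mul_pos_iff_of_pos_left (mul_pos (hs s₁) (hpos s₁))).1 h₁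
    · rw [← mul_assoc] at h₂
      exact neg_of_mul_neg_right h₂ (mul_pos (hs s₂) (hpos s₂)).le
  · refine not_cos_changes_sign (r := fun s => -l s * ‖γ' s‖) (k := k) (A := fun s => -u s)
      hT hθ hθper
      (fun s => mul_pos (neg_pos.2 (hs s)) (hpos s)) (fun s => by rw [hu, hcos]; ring)
      (fun s => (hu' s).neg.congr_deriv (by rw [hv, hsin]; ring)) hk (s₁ := s₂) (s₂ := s₁) ?_ ?_
    · have := mul_pos (neg_pos.2 (hs s₂)) (hpos s₂)
      exact (mul_pos_iff_of_pos_left this).1 (by linarith)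
    · have := mul_pos (neg_pos.2 (hs s₁)) (hpos s₁)
      exact neg_of_mul_neg_right (a := -l s₁ * ‖γ' s₁‖) (by linarith) this.le

theorem fderiv_prod_apply_eq (f : ℝ × ℝ → ℝ) (p : ℝ × ℝ) (a b : ℝ) :
    fderiv ℝ f p (a, b) = a * pdX f p + b * pdY f p := by
  have : ((a, b) : ℝ × ℝ) = a • (1, 0) + b • (0, 1) := by simp
  rw [this, map_add, map_smul, map_smul, smul_eq_mul, smul_eq_mul, pdX, pdY]

theorem continuous_pdX {f : ℝ × ℝ → ℝ} (hf : ContDiff ℝ 1 f) : Continuous (pdX f) :=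
  (hf.continuous_fderiv one_ne_zero).clm_apply continuous_const

theorem continuous_pdY {f : ℝ × ℝ → ℝ} (hf : ContDiff ℝ 1 f) : Continuous (pdY f) :=
  (hf.continuous_fderiv one_ne_zero).clm_apply continuous_const

namespace GenPeriodicFlow

variable {g Patm L d : ℝ} (F : GenPeriodicFlow g Patm L d)

theorem injective_param (hL : 0 < L) : Function.Injective fun s => (F.X s, F.Y s) := by
  intro s s' h
  obtain ⟨hx, hy⟩ := Prod.ext_iff.1 h
  obtain ⟨n, hn⟩ := F.S_simple s s' hx hy
  have hp : Function.Periodic (fun s => F.X s - 2 * L / F.T * s) F.T := fun s => by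
    have := F.T_pos.ne'
    simp only [F.X_per]; field_simp; ring
  have h1 := hp.int_mul n s
  simp only [← hn] at h1
  have hT := F.T_pos
  have h2 : 2 * L / F.T * (s' - s) = 0 := by simp only at hx; linarith
  have h3 : 2 * L / F.T ≠ 0 := by positivity
  linarith [(mul_eq_zero.1 h2).resolve_left h3]

theorem surf_mem_closure (s : ℝ) : (F.X s, F.Y s) ∈ closure F.Ω :=
  frontier_subset_closure (F.Ω_frontier ▸ Or.inl ⟨s, rfl⟩)

theorem euler_x_closure {p : ℝ × ℝ} (hp : p ∈ closure F.Ω) :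
    F.u p * pdX F.u p + F.v p * pdY F.u p = -pdX F.P p := by
  have hP : ContDiff ℝ 1 F.P := F.P_smooth.of_le (by norm_num)
  have h1 := continuous_pdX F.u_smooth
  have h2 := continuous_pdY F.u_smooth
  have h3 := continuous_pdX hP
  have h4 := F.u_smooth.continuous
  have h5 := F.v_smooth.continuous
  exact EqOn.closure (s := F.Ω) (f := fun p => F.u p * pdX F.u p + F.v p * pdY F.u p)
    (g := fun p => -pdX F.P p) F.euler_x (by fun_prop) (by fun_prop) hp

theorem hasDerivAt_comp_param {f : ℝ × ℝ → ℝ} (hf : ContDiff ℝ 1 f) (s : ℝ) :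
    HasDerivAt (fun s => f (F.X s, F.Y s))
      (deriv F.X s * pdX f (F.X s, F.Y s) + deriv F.Y s * pdY f (F.X s, F.Y s)) s := by
  rw [← fderiv_prod_apply_eq]
  exact ((hf.differentiable one_ne_zero _).hasFDerivAt).comp_hasDerivAt
    (f := fun s => (F.X s, F.Y s)) s
    ((F.X_smooth.differentiable two_ne_zero s).hasDerivAt.prodMk
      (F.Y_smooth.differentiable two_ne_zero s).hasDerivAt)

/-- One of the two sides of the free surface lies in the fluid and the other one outside. -/
theorem exists_outward_side (hL : 0 < L) : ∃ τ : ℝ, |τ| = 1 ∧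
    (∀ s, SideOut F.X F.Y F.Ω τ s) ∧ ∀ s, SideIn F.X F.Y F.Ω (-τ) s := by
  have hemb := isEmbedding_of_add_period F.T_pos (by linarith : 0 < 2 * L)
    F.X_smooth.continuous F.Y_smooth.continuous F.X_per (F.injective_param hL)
  have hB : IsClosed {p : ℝ × ℝ | p.2 = -d} := isClosed_eq continuous_snd continuous_const
  have hSB : ∀ s, (F.X s, F.Y s) ∉ {p : ℝ × ℝ | p.2 = -d} := fun s h => (F.S_above_bed s).ne' h
  have side := fun (τ : ℝ) (hτ : |τ| = 1) => forall_sideIn_or_forall_sideOut F.X_smooth F.Y_smooth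
    F.regular hemb hB hSB F.Ω_open F.Ω_frontier hτ
  rcases side 1 (by simp) with h1 | h1 <;> rcases side (-1) (by simp) with h2 | h2
  · exact (not_sideIn_both F.T_pos (by linarith : 0 < 2 * L) F.X_smooth F.Y_smooth F.regular hemb
      F.X_per F.Y_per F.S_above_bed F.Ω_open F.Ω_conn.isPreconnected F.Ω_frontier h1 h2).elim
  · exact ⟨-1, by simp, h2, by simpa using h1⟩
  · exact ⟨1, by simp, h1, h2⟩
  · exact (not_sideOut_both F.X_smooth F.Y_smooth F.regular hemb hB hSB F.Ω_open F.Ω_frontier 0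
      (h1 0) (h2 0)).elim

/-- On an overturning surface without stagnation points the pressure has a positive derivative in
the direction of either of the two normal fields somewhere. -/
theorem exists_normal_fderiv_pos (hL : 0 < L)
    (hS : ∀ s, F.u (F.X s, F.Y s) ^ 2 + F.v (F.X s, F.Y s) ^ 2 ≠ 0)
    (hover_pos : ∃ s, 0 < F.u (F.X s, F.Y s))
    (hover_neg : ∃ s, F.u (F.X s, F.Y s) < 0) {τ : ℝ} (hτ : |τ| = 1) :
    ∃ s, 0 < fderiv ℝ F.P (F.X s, F.Y s) (τ * -deriv F.Y s, τ * deriv F.X s) := by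
  by_contra! hcon
  obtain ⟨s₁, h₁⟩ := hover_pos
  obtain ⟨s₂, h₂⟩ := hover_neg
  have hP1 : ContDiff ℝ 1 F.P := F.P_smooth.of_le (by norm_num)
  set X' := deriv F.X with hX'
  set Y' := deriv F.Y with hY'
  set U : ℝ → ℝ := fun s => F.u (F.X s, F.Y s) with hU
  set V : ℝ → ℝ := fun s => F.v (F.X s, F.Y s) with hV
  set ρ : ℝ → ℝ := fun s => X' s ^ 2 + Y' s ^ 2 with hρ
  set l : ℝ → ℝ := fun s => (U s * X' s + V s * Y' s) / ρ s with hl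
  set Px : ℝ → ℝ := fun s => pdX F.P (F.X s, F.Y s) with hPx
  set Py : ℝ → ℝ := fun s => pdY F.P (F.X s, F.Y s) with hPy
  have hreg : ∀ s, ρ s ≠ 0 := F.regular
  have hρpos : ∀ s, 0 < ρ s := fun s => lt_of_le_of_ne (by positivity) (hreg s).symm
  have htan : ∀ s, U s * Y' s = V s * X' s := F.surface_tangency
  have hUl : ∀ s, U s = l s * X' s := fun s => by
    rw [hl, div_mul_eq_mul_div, eq_div_iff (hreg s)]
    linear_combination Y' s * htan s
  have hVl : ∀ s, V s = l s * Y' s := fun s => by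
    rw [hl, div_mul_eq_mul_div, eq_div_iff (hreg s)]
    linear_combination -X' s * htan s
  have hl0 : ∀ s, l s ≠ 0 := fun s h => hS s (by
    change U s ^ 2 + V s ^ 2 = 0
    rw [hUl, hVl, h]; ring)
  have hlc : Continuous l := by
    have h1 := F.u_smooth.continuous
    have h2 := F.v_smooth.continuous
    have h3 := F.X_smooth.continuous
    have h4 := F.Y_smooth.continuous
    have h5 : Continuous X' := F.X_smooth.continuous_deriv (by norm_num)
    have h6 : Continuous Y' := F.Y_smooth.continuous_deriv (by norm_num)
    exact Continuous.div (by fun_prop) (by fun_prop) hreg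
  have hPtan : ∀ s, X' s * Px s + Y' s * Py s = 0 := fun s =>
    (F.hasDerivAt_comp_param hP1 s).unique
      ((hasDerivAt_const s Patm).congr_of_eventuallyEq (.of_forall F.surface_pressure))
  have hPn : ∀ s, τ * (Py s * X' s - Px s * Y' s) ≤ 0 := fun s => by
    have := hcon s
    rw [fderiv_prod_apply_eq] at this
    linarith
  have hden : ∀ s, 0 < ρ s * l s ^ 2 := fun s =>
    mul_pos (hρpos s) (by have := hl0 s; positivity)
  refine not_horizontal_velocity_changes_sign (u := U) (v := V) (l := l)
    (k := fun s => (Py s * X' s - Px s * Y' s) / (ρ s * l s ^ 2)) F.T_pos F.X_smooth F.Y_smooth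
    F.regular F.X_per F.Y_per (F.injective_param hL) hlc hl0 hUl hVl (fun s => ?_) ?_ h₁ h₂
  · refine (F.hasDerivAt_comp_param F.u_smooth s).congr_deriv ?_
    have he : U s * pdX F.u (F.X s, F.Y s) + V s * pdY F.u (F.X s, F.Y s) = -Px s :=
      F.euler_x_closure (F.surf_mem_closure s)
    have hls := hl0 s
    rw [hUl, hVl] at he
    rw [hVl, div_mul_eq_mul_div, eq_div_iff (hden s).ne']
    simp only [hρ]
    linear_combination (X' s ^ 2 + Y' s ^ 2) * l s * he - l s * X' s * hPtan s
  · rcases eq_or_eq_neg_of_abs_eq hτ with h | h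
    · refine .inl fun s => div_nonpos_of_nonpos_of_nonneg ?_ (hden s).le
      have := hPn s
      rw [h] at this; linarith
    · refine .inr fun s => div_nonneg ?_ (hden s).le
      have := hPn s
      rw [h] at this; linarith

end GenPeriodicFlow

/-- **Overturning periodic waves must have a pressure sink.**  Suppose `u² + v² ≠ 0` at
every point of the free surface `S`.  If the wave overturns, i.e. `u` takes both strictly
positive and strictly negative values along `S`, then there is a point of `S` where the
outward normal derivative of `P` is strictly positive; in particular `P` does not attain
its minimum over the closure of `Ω` on the free surface. -/
theorem overturning_periodic_pressure_sink (g Patm L d : ℝ) (hg : 0 < g) (hL : 0 < L)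
    (hd : 0 < d)
    (F : GenPeriodicFlow g Patm L d)
    (hS : ∀ s, F.u (F.X s, F.Y s) ^ 2 + F.v (F.X s, F.Y s) ^ 2 ≠ 0)
    (hover_pos : ∃ s, 0 < F.u (F.X s, F.Y s))
    (hover_neg : ∃ s, F.u (F.X s, F.Y s) < 0) :
    (∃ s, ∃ n : ℝ × ℝ, F.IsOutwardNormalAt n s ∧ 0 < fderiv ℝ F.P (F.X s, F.Y s) n) ∧
    (∀ s, ∃ p ∈ closure F.Ω, F.P p < F.P (F.X s, F.Y s)) := by
  obtain ⟨τ, hτ, hout, hin⟩ := F.exists_outward_side hL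
  obtain ⟨s, hs⟩ := F.exists_normal_fderiv_pos hL hS hover_pos hover_neg hτ
  refine ⟨⟨s, (τ * -deriv F.Y s, τ * deriv F.X s), ⟨by ring, ?_⟩, hs⟩, fun s' => ?_⟩
  · obtain ⟨δ, hδ, h⟩ := hout s
    refine ⟨δ, hδ, fun t h1 h2 => ?_⟩
    convert h t h1 h2 using 3 <;> simp only [normalCollar] <;> ring
  · obtain ⟨δ, hδ, h⟩ := hin s
    set n : ℝ × ℝ := (τ * -deriv F.Y s, τ * deriv F.X s) with hn
    have hline : HasDerivAt (fun t : ℝ => F.P ((F.X s, F.Y s) - t • n))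
        (-fderiv ℝ F.P (F.X s, F.Y s) n) 0 := by
      have h1 : HasDerivAt (fun t : ℝ => (F.X s, F.Y s) - t • n) (-n) 0 := by
        simpa using ((hasDerivAt_id (0 : ℝ)).smul_const n).const_sub (F.X s, F.Y s)
      have h2 : HasFDerivAt F.P (fderiv ℝ F.P (F.X s, F.Y s)) ((F.X s, F.Y s) - (0 : ℝ) • n) := by
        simpa using (F.P_smooth.differentiable two_ne_zero (F.X s, F.Y s)).hasFDerivAt
      simpa [Function.comp_def] using h2.comp_hasDerivAt (0 : ℝ) h1
    have hslope := (hline.tendsto_slope_zero_right).eventually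
      (gt_mem_nhds (show -fderiv ℝ F.P (F.X s, F.Y s) n < 0 by linarith))
    obtain ⟨t, ht, ht0, htδ⟩ := (hslope.and (Ioo_mem_nhdsGT hδ)).exists
    refine ⟨_, subset_closure (h t ht0 htδ), ?_⟩
    have hpt : normalCollar F.X F.Y (s, -τ * t) = (F.X s, F.Y s) - t • n := by
      simp only [normalCollar, hn, Prod.smul_mk, Prod.mk_sub_mk, smul_eq_mul, Prod.mk.injEq]
      constructor <;> ring
    have hP := (F.surface_pressure s').trans (F.surface_pressure s).symm
    rw [hpt]
    simp only [zero_add, zero_smul, sub_zero, smul_eq_mul] at ht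
    have := neg_of_mul_neg_right ht (inv_pos.2 ht0).le
    linarith
end

section
/- (Overturning solitary waves must have a pressure sink.) Assume that u² + v² ≥ δ > 0 on the free surface S for some constant δ. If the wave overturns, meaning that u takes both strictly positive and strictly negative values along S, then there exists a point of S at which ∂P/∂n > 0; in particular, the pressure P does not attain its minimum over the closure of Ω on the free surface S. -/
open Set Filter

/-- A general (possibly overturning, possibly asymmetric) steady solitary water wave.
The free surface `S` is a non-self-intersecting regular `C²` curve parametrized by
`s ↦ (X s, Y s)`, lying above the bed `B = {y = -d}`, which outside a compact set of
`x`-values is the graph of a `C²` function `η` with `η → 0` and `η' → 0` as `x → ±∞`.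
The fluid domain `Ω` is the open connected region whose boundary is `S ∪ B`.  The
bounded flow `(u, v)` with pressure `P` solves the steady Euler equations in `Ω`, is
tangent to `S`, has `P = Patm` on `S`, `v = 0` on `B`, and `P − Patm + g y → 0`
uniformly in `y` as `x → ±∞`. -/
structure GenSolitaryFlow (g Patm d : ℝ) : Type where
  X : ℝ → ℝ
  Y : ℝ → ℝ
  η : ℝ → ℝ
  u : ℝ × ℝ → ℝ
  v : ℝ × ℝ → ℝ
  P : ℝ × ℝ → ℝ
  Ω : Set (ℝ × ℝ)
  X_smooth : ContDiff ℝ 2 X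
  Y_smooth : ContDiff ℝ 2 Y
  regular : ∀ s, deriv X s ^ 2 + deriv Y s ^ 2 ≠ 0
  S_simple : Function.Injective fun s => (X s, Y s)
  X_proper_top : Tendsto X atTop atTop
  X_proper_bot : Tendsto X atBot atBot
  S_above_bed : ∀ s, -d < Y s
  η_smooth : ContDiff ℝ 2 η
  graph_outside : ∃ R : ℝ, ∀ s, R ≤ |X s| → Y s = η (X s)
  η_lim_top : Tendsto η atTop (nhds 0)
  η_lim_bot : Tendsto η atBot (nhds 0)
  η'_lim_top : Tendsto (deriv η) atTop (nhds 0)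
  η'_lim_bot : Tendsto (deriv η) atBot (nhds 0)
  Ω_open : IsOpen Ω
  Ω_conn : IsConnected Ω
  Ω_frontier : frontier Ω = (range fun s => (X s, Y s)) ∪ {p : ℝ × ℝ | p.2 = -d}
  u_smooth : ContDiff ℝ 1 u
  v_smooth : ContDiff ℝ 1 v
  P_smooth : ContDiff ℝ 2 P
  u_bounded : ∃ C, ∀ p ∈ closure Ω, |u p| ≤ C
  v_bounded : ∃ C, ∀ p ∈ closure Ω, |v p| ≤ C
  P_bounded : ∃ C, ∀ p ∈ closure Ω, |P p| ≤ C
  euler_x : ∀ p ∈ Ω, u p * pdX u p + v p * pdY u p = -pdX P p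
  euler_y : ∀ p ∈ Ω, u p * pdX v p + v p * pdY v p = -(pdY P p) - g
  incompressible : ∀ p ∈ Ω, pdX u p + pdY v p = 0
  surface_pressure : ∀ s, P (X s, Y s) = Patm
  surface_tangency : ∀ s, u (X s, Y s) * deriv Y s = v (X s, Y s) * deriv X s
  bed_kinematic : ∀ x, v (x, -d) = 0
  P_asymptotic : ∀ ε > 0, ∃ R, ∀ p ∈ closure Ω, R ≤ |p.1| → |P p - Patm + g * p.2| < ε

namespace GenSolitaryFlow

variable {g Patm d : ℝ}

/-- `n` is an outward (non-fluid side) normal to `S` at the parameter `s`: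
it is orthogonal to the tangent vector and points out of the fluid. -/
def IsOutwardNormalAt (F : GenSolitaryFlow g Patm d) (n : ℝ × ℝ) (s : ℝ) : Prop :=
  n.1 * deriv F.X s + n.2 * deriv F.Y s = 0 ∧
  ∃ t₀ > 0, ∀ t, 0 < t → t < t₀ → (F.X s + t * n.1, F.Y s + t * n.2) ∉ closure F.Ω

end GenSolitaryFlow

/-- A nowhere vanishing continuous function on the plane has a continuous logarithm with a
prescribed value at one point. -/
theorem exists_continuous_log {h : ℝ × ℝ → ℂ} (hc : Continuous h) (h0 : ∀ p, h p ≠ 0)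
    (p₀ : ℝ × ℝ) : ∃ Θ : ℝ × ℝ → ℂ, Continuous Θ ∧ (∀ p, Complex.exp (Θ p) = h p) ∧
      Θ p₀ = Complex.log (h p₀) := by
  obtain ⟨F, ⟨hF0, hF⟩, -⟩ := Complex.isCoveringMapOn_exp.existsUnique_continuousMap_lifts
    ⟨h, hc⟩ (a₀ := p₀) (e₀ := Complex.log (h p₀)) (Complex.exp_log (h0 p₀)) (fun p => h0 p)
  exact ⟨F, F.continuous, fun p => congrFun hF p, hF0⟩

/-- The averaged derivative `∫₀¹ f'(s + r (t - s)) dr`. -/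
noncomputable def avgDeriv (f : ℝ → ℝ) (p : ℝ × ℝ) : ℝ :=
  ∫ r in (0 : ℝ)..1, deriv f (p.1 + r * (p.2 - p.1))

theorem continuous_avgDeriv {f : ℝ → ℝ} (hf : Continuous (deriv f)) :
    Continuous (avgDeriv f) := by
  apply intervalIntegral.continuous_parametric_intervalIntegral_of_continuous'
  exact hf.comp (by fun_prop)

theorem avgDeriv_self (f : ℝ → ℝ) (s : ℝ) : avgDeriv f (s, s) = deriv f s := by
  simp [avgDeriv]

theorem mul_avgDeriv {f : ℝ → ℝ} (hf : ContDiff ℝ 1 f) (s t : ℝ) :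
    (t - s) * avgDeriv f (s, t) = f t - f s := by
  have hd : Continuous (deriv f) := hf.continuous_deriv le_rfl
  have h := intervalIntegral.mul_integral_comp_add_mul (f := deriv f) (a := 0) (b := 1)
    (c := t - s) (d := s)
  simp only [avgDeriv]
  rw [show (fun r : ℝ => deriv f (s + r * (t - s))) = fun r => deriv f (s + (t - s) * r) by
    ext r; ring_nf, h]
  rw [intervalIntegral.integral_deriv_eq_sub (fun x _ => hf.differentiable one_ne_zero x)
    (hd.intervalIntegrable _ _)]
  simp

/-- A continuous function whose cosine stays positive cannot leave `(-π/2, π/2)`. -/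
theorem abs_lt_pi_div_two_of_cos_pos {f : ℝ → ℝ} {a b : ℝ} (hab : a ≤ b)
    (hf : ContinuousOn f (Icc a b)) (hcos : ∀ t ∈ Icc a b, 0 < Real.cos (f t))
    (ha : |f a| < Real.pi / 2) : |f b| < Real.pi / 2 := by
  by_contra! hb
  obtain ⟨t, ht, hft⟩ := intermediate_value_Icc hab hf.abs ⟨ha.le, hb⟩
  have := hcos t ht
  rw [← Real.cos_abs, show |f t| = Real.pi / 2 from hft, Real.cos_pi_div_two] at this
  exact this.false

theorem cos_im_pos_of_exp_re_pos {z : ℂ} (h : 0 < (Complex.exp z).re) : 0 < Real.cos z.im := by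
  rw [Complex.exp_re] at h
  exact pos_of_mul_pos_right h (Real.exp_pos _).le

/-- For a simple regular arc lying strictly to the right of its initial point and strictly to the
left of its end point, a continuous tangent angle has the same branch at both ends. -/
theorem exists_tangent_angle {X Y : ℝ → ℝ} (hX : ContDiff ℝ 1 X) (hY : ContDiff ℝ 1 Y)
    (hreg : ∀ s, deriv X s ^ 2 + deriv Y s ^ 2 ≠ 0)
    (hinj : Function.Injective fun s => (X s, Y s)) {a b : ℝ} (hab : a < b)
    (ha : ∀ t > a, X a < X t) (hb : ∀ t < b, X t < X b)
    (ha' : 0 < deriv X a) (hb' : 0 < deriv X b) :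
    ∃ Θ : ℝ → ℂ, Continuous Θ ∧ (∀ s, Complex.exp (Θ s) = deriv X s + deriv Y s * Complex.I) ∧
      |(Θ a).im| < Real.pi / 2 ∧ |(Θ b).im| < Real.pi / 2 := by
  let h : ℝ × ℝ → ℂ := fun p => avgDeriv X p + avgDeriv Y p * Complex.I
  have hre : ∀ p, (h p).re = avgDeriv X p := fun p => by simp [h]
  have him : ∀ p, (h p).im = avgDeriv Y p := fun p => by simp [h]
  have hc : Continuous h := by
    have h1 := continuous_avgDeriv (hX.continuous_deriv le_rfl)
    have h2 := continuous_avgDeriv (hY.continuous_deriv le_rfl)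
    fun_prop
  have h0 : ∀ p, h p ≠ 0 := by
    rintro ⟨s, t⟩ hst
    have hx : avgDeriv X (s, t) = 0 := by rw [← hre, hst, Complex.zero_re]
    have hy : avgDeriv Y (s, t) = 0 := by rw [← him, hst, Complex.zero_im]
    rcases eq_or_ne s t with rfl | hne
    · rw [avgDeriv_self] at hx hy
      exact hreg s (by rw [hx, hy]; norm_num)
    · have h1 := mul_avgDeriv hX s t
      have h2 := mul_avgDeriv hY s t
      rw [hx] at h1
      rw [hy] at h2
      exact hne (hinj (Prod.ext (by simp only; linarith) (by simp only; linarith)))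
  obtain ⟨Θ, hΘc, hΘ, hΘ0⟩ := exists_continuous_log hc h0 (a, a)
  have hpos : ∀ s t, s ≤ t → (s = a ∨ t = b) → s ∈ Icc a b → t ∈ Icc a b →
      0 < Real.cos (Θ (s, t)).im := by
    intro s t hst hor hs ht
    apply cos_im_pos_of_exp_re_pos
    rw [hΘ, hre]
    rcases hst.eq_or_lt with rfl | hlt
    · rw [avgDeriv_self]
      rcases hor with rfl | rfl <;> assumption
    · have h1 := mul_avgDeriv hX s t
      have h2 : X s < X t := by
        rcases hor with rfl | rfl
        · exact ha t hlt
        · exact hb s hlt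
      exact pos_of_mul_pos_right (a := t - s) (by linarith) (by linarith)
  have haa : |(Θ (a, a)).im| < Real.pi / 2 := by
    rw [hΘ0, Complex.log_im, Complex.abs_arg_lt_pi_div_two_iff, hre, avgDeriv_self]
    exact Or.inl ha'
  have hca : ContinuousOn (fun t => (Θ (a, t)).im) (Icc a b) := by fun_prop
  have hcb : ContinuousOn (fun s => (Θ (s, b)).im) (Icc a b) := by fun_prop
  have hab' := abs_lt_pi_div_two_of_cos_pos hab.le hca
    (fun t ht => hpos a t ht.1 (.inl rfl) ⟨le_rfl, hab.le⟩ ht) haa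
  have hbb := abs_lt_pi_div_two_of_cos_pos hab.le hcb
    (fun s hs => hpos s b hs.2 (.inr rfl) hs ⟨hab.le, le_rfl⟩) hab'
  exact ⟨fun s => Θ (s, s), by fun_prop, fun s => by simp [hΘ, h, avgDeriv_self], haa, hbb⟩

/-- A continuous logarithm of a differentiable function is differentiable. -/
theorem hasDerivAt_of_exp_eq {Θ z : ℝ → ℂ} {z' : ℂ} {s : ℝ} (hΘ : ContinuousAt Θ s)
    (hexp : ∀ t, Complex.exp (Θ t) = z t) (hz : HasDerivAt z z' s) :
    HasDerivAt Θ (z' / z s) s := by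
  have hz0 : z s ≠ 0 := by rw [← hexp]; exact Complex.exp_ne_zero _
  have h1 : HasDerivAt (fun t => Θ s + Complex.log (z t / z s)) (z' / z s) s := by
    have h2 := (hz.div_const (z s)).clog_real (by simp [hz0])
    simpa [hz0] using h2.const_add (Θ s)
  refine h1.congr_of_eventuallyEq ?_
  have h3 : ContinuousAt (fun t => |(Θ t - Θ s).im|) s := by fun_prop
  have h4 : ∀ᶠ t in nhds s, |(Θ t - Θ s).im| < Real.pi :=
    h3.eventually_lt continuousAt_const (by simpa using Real.pi_pos)
  filter_upwards [h4] with t ht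
  rw [abs_lt] at ht
  rw [← hexp, ← hexp, ← Complex.exp_sub, Complex.log_exp ht.1 ht.2.le]
  ring

/-- An angle which increases strictly wherever it equals `c` cannot drop below `c`. -/
theorem le_of_deriv_pos_at_level {θ θ' : ℝ → ℝ} (hθ : ∀ s, HasDerivAt θ (θ' s) s) {c : ℝ}
    (hc : ∀ s, θ s = c → 0 < θ' s) {a b : ℝ} (hab : a ≤ b) (ha : c ≤ θ a) : c ≤ θ b := by
  have := image_le_of_deriv_right_lt_deriv_boundary (f := fun s => -θ s) (f' := fun s => -θ' s)
    (a := a) (b := b) (B := fun _ => -c) (B' := fun _ => 0)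
    (fun s _ => (hθ s).neg.continuousAt.continuousWithinAt)
    (fun s _ => (hθ s).neg.hasDerivWithinAt) (by simpa using ha)
    (fun s => hasDerivAt_const s _)
    (fun s _ h => by simpa using hc s (by simpa using h)) ⟨hab, le_rfl⟩
  simpa using this

/-- A simple regular arc lying between the vertical lines through its end points that turns
counterclockwise wherever it runs backwards never runs backwards. -/
theorem deriv_nonneg_of_turning {X Y : ℝ → ℝ} (hX : ContDiff ℝ 2 X) (hY : ContDiff ℝ 2 Y)
    (hreg : ∀ s, deriv X s ^ 2 + deriv Y s ^ 2 ≠ 0)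
    (hinj : Function.Injective fun s => (X s, Y s)) {a b : ℝ}
    (ha : ∀ t > a, X a < X t) (hb : ∀ t < b, X t < X b)
    (ha' : 0 < deriv X a) (hb' : 0 < deriv X b)
    (hturn : ∀ s, deriv X s < 0 →
      0 < deriv X s * deriv (deriv Y) s - deriv Y s * deriv (deriv X) s)
    {s : ℝ} (has : a ≤ s) (hsb : s ≤ b) : 0 ≤ deriv X s := by
  rcases (has.trans hsb).eq_or_lt with rfl | hab
  · rw [le_antisymm hsb has]; exact ha'.le
  by_contra! hneg
  obtain ⟨Θ, hΘc, hΘ, hΘa, hΘb⟩ := exists_tangent_angle (hX.of_le one_le_two)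
    (hY.of_le one_le_two) hreg hinj hab ha hb ha' hb'
  have hX' : ∀ t, HasDerivAt (deriv X) (deriv (deriv X) t) t := fun t =>
    ((hX.iterate_deriv' 1 1).differentiable one_ne_zero t).hasDerivAt
  have hY' : ∀ t, HasDerivAt (deriv Y) (deriv (deriv Y) t) t := fun t =>
    ((hY.iterate_deriv' 1 1).differentiable one_ne_zero t).hasDerivAt
  have hcos : ∀ t, deriv X t = Real.exp (Θ t).re * Real.cos (Θ t).im := fun t => by
    rw [← Complex.exp_re, hΘ]; simp
  have hder : ∀ t, HasDerivAt (fun t => (Θ t).im)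
      ((deriv X t * deriv (deriv Y) t - deriv Y t * deriv (deriv X) t) /
        (deriv X t ^ 2 + deriv Y t ^ 2)) t := by
    intro t
    have h1 := hasDerivAt_of_exp_eq hΘc.continuousAt hΘ
      ((hX' t).ofReal_comp.add ((hY' t).ofReal_comp.mul_const Complex.I))
    have h2 := Complex.imCLM.hasFDerivAt.comp_hasDerivAt t h1
    refine h2.congr_deriv ?_
    simp [Complex.div_im, Complex.normSq_apply]
    field_simp
  have hlevel : ∀ c, Real.cos c < 0 → ∀ t, (Θ t).im = c →
      0 < (deriv X t * deriv (deriv Y) t - deriv Y t * deriv (deriv X) t) /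
        (deriv X t ^ 2 + deriv Y t ^ 2) := by
    intro c hc t ht
    refine div_pos (hturn t ?_) (lt_of_le_of_ne (by positivity) (hreg t).symm)
    rw [hcos, ht]
    exact mul_neg_of_pos_of_neg (Real.exp_pos _) hc
  have hcs : Real.cos (Θ s).im < 0 := by
    have := hcos s
    by_contra! h
    have := mul_nonneg (Real.exp_pos (Θ s).re).le h
    linarith
  rw [abs_lt] at hΘa hΘb
  have hpi := Real.pi_pos
  rcases lt_or_ge (Real.pi / 2) (Θ s).im with h | h
  · have hc : Real.cos (min (Θ s).im Real.pi) < 0 :=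
      Real.cos_neg_of_pi_div_two_lt_of_lt (lt_min h (by linarith))
        ((min_le_right _ _).trans_lt (by linarith))
    have := le_of_deriv_pos_at_level hder (hlevel _ hc) hsb (min_le_left _ _)
    have := lt_min h (show Real.pi / 2 < Real.pi by linarith)
    linarith
  · have h' : (Θ s).im < -(Real.pi / 2) := by
      by_contra! h2
      exact hcs.not_ge (Real.cos_nonneg_of_neg_pi_div_two_le_of_le (by linarith) h)
    obtain ⟨c, hc1, hc2⟩ := exists_between (max_lt h' (show -Real.pi < -(Real.pi / 2) by linarith))
    rw [max_lt_iff] at hc1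
    have hc : Real.cos c < 0 := by
      rw [← Real.cos_neg]
      exact Real.cos_neg_of_pi_div_two_lt_of_lt (by linarith) (by linarith)
    have := le_of_deriv_pos_at_level hder (hlevel _ hc) has (by linarith)
    linarith

/-- A continuous function tending to `-∞` at `-∞` and to `+∞` at `+∞` takes some value below any
given level for the last time, arbitrarily far to the left. -/
theorem exists_last_time {f : ℝ → ℝ} (hf : Continuous f) (htop : Tendsto f atTop atTop)
    (hbot : Tendsto f atBot atBot) (s K : ℝ) :
    ∃ a < s, f a < K ∧ ∀ t > a, f a < f t := by
  obtain ⟨T, hT⟩ := (htop.eventually_ge_atTop 0).exists_forall_of_atTop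
  obtain ⟨m, hm⟩ := (isCompact_Icc (a := s) (b := T)).bddBelow_image hf.continuousOn
  obtain ⟨c, hc⟩ := exists_lt (min K (min m 0))
  simp only [lt_min_iff] at hc
  have hsub : {t | f t ≤ c} ⊆ Iio s := by
    intro t ht
    by_contra! hst
    rcases le_total t T with h | h
    · have := hm (mem_image_of_mem f ⟨not_lt.1 hst, h⟩)
      have : f t ≤ c := ht
      linarith
    · have := hT t h
      have : f t ≤ c := ht
      linarith
  have hbdd : BddAbove {t | f t ≤ c} := ⟨s, fun t ht => (hsub ht).le⟩
  have hne : {t | f t ≤ c}.Nonempty := (hbot.eventually_le_atBot c).exists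
  have hmem := (isClosed_le hf continuous_const).csSup_mem hne hbdd
  refine ⟨sSup {t | f t ≤ c}, hsub hmem, lt_of_le_of_lt hmem hc.1, fun t ht => ?_⟩
  by_contra! h
  exact (le_csSup hbdd (h.trans hmem)).not_gt ht

theorem deriv_nonneg_of_forall_gt {f : ℝ → ℝ} {a : ℝ} (hf : DifferentiableAt ℝ f a)
    (h : ∀ t > a, f a < f t) : 0 ≤ deriv f a := by
  have h1 := (hasDerivAt_iff_tendsto_slope.1 hf.hasDerivAt).mono_left
    (nhdsWithin_mono a (show Ioi a ⊆ {a}ᶜ from fun t ht => ht.ne'))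
  refine ge_of_tendsto h1 (eventually_mem_nhdsWithin.mono fun t ht => ?_)
  rw [slope_def_field]
  exact div_nonneg (sub_nonneg.2 (h t ht).le) (sub_nonneg.2 (le_of_lt ht))

theorem exists_first_time {f : ℝ → ℝ} (hf : Continuous f) (htop : Tendsto f atTop atTop)
    (hbot : Tendsto f atBot atBot) (s K : ℝ) :
    ∃ b > s, K < f b ∧ ∀ t < b, f t < f b := by
  obtain ⟨a, has, haK, ha⟩ := exists_last_time (f := fun t => -f (-t)) (by fun_prop)
    (tendsto_neg_atBot_atTop.comp (hbot.comp tendsto_neg_atTop_atBot))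
    (tendsto_neg_atTop_atBot.comp (htop.comp tendsto_neg_atBot_atTop)) (-s) (-K)
  refine ⟨-a, by linarith, by linarith, fun t ht => ?_⟩
  have := ha (-t) (by linarith)
  simp only [neg_neg] at this
  linarith

theorem deriv_nonneg_of_forall_lt {f : ℝ → ℝ} {b : ℝ} (hf : DifferentiableAt ℝ f b)
    (h : ∀ t < b, f t < f b) : 0 ≤ deriv f b := by
  have h1 := (hasDerivAt_iff_tendsto_slope.1 hf.hasDerivAt).mono_left
    (nhdsWithin_mono b (show Iio b ⊆ {b}ᶜ from fun t ht => ht.ne))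
  refine ge_of_tendsto h1 (eventually_mem_nhdsWithin.mono fun t ht => ?_)
  rw [slope_def_field]
  exact div_nonneg_of_nonpos (sub_nonpos.2 (h t ht).le) (sub_nonpos.2 (le_of_lt ht))

/-- A preconnected set missing the frontier of an open set lies inside it or outside its
closure. -/
theorem IsPreconnected.subset_or_subset_compl_closure {α : Type*} [TopologicalSpace α]
    {Ω A : Set α} (hΩ : IsOpen Ω) (hA : IsPreconnected A) (h : ∀ p ∈ A, p ∉ frontier Ω) :
    A ⊆ Ω ∨ A ⊆ (closure Ω)ᶜ := by
  refine hA.subset_or_subset hΩ isClosed_closure.isOpen_compl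
    (disjoint_compl_right.mono_left subset_closure |>.mono_right le_rfl) fun p hp => ?_
  by_cases hpc : p ∈ closure Ω
  · left
    by_contra hpΩ
    exact h p hp (by rw [hΩ.frontier_eq]; exact ⟨hpc, hpΩ⟩)
  · exact .inr hpc

/-- The normal coordinates `(s, t) ↦ γ(s) + t N(s)` along the curve `γ = (X, Y)`, where
`N = (-Y', X')`. -/
noncomputable def normalMap (X Y : ℝ → ℝ) (p : ℝ × ℝ) : ℝ × ℝ :=
  (X p.1 - p.2 * deriv Y p.1, Y p.1 + p.2 * deriv X p.1)

theorem contDiff_normalMap {X Y : ℝ → ℝ} (hX : ContDiff ℝ 2 X) (hY : ContDiff ℝ 2 Y) :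
    ContDiff ℝ 1 (normalMap X Y) := by
  have h1 : ContDiff ℝ 1 (deriv X) := hX.iterate_deriv' 1 1
  have h2 : ContDiff ℝ 1 (deriv Y) := hY.iterate_deriv' 1 1
  have h3 : ContDiff ℝ 1 X := hX.of_le one_le_two
  have h4 : ContDiff ℝ 1 Y := hY.of_le one_le_two
  unfold normalMap
  fun_prop

theorem exists_equiv_hasStrictFDerivAt_normalMap {X Y : ℝ → ℝ} (hX : ContDiff ℝ 2 X)
    (hY : ContDiff ℝ 2 Y) {s : ℝ} (hreg : deriv X s ^ 2 + deriv Y s ^ 2 ≠ 0) :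
    ∃ e : (ℝ × ℝ) ≃L[ℝ] ℝ × ℝ,
      HasStrictFDerivAt (normalMap X Y) (e : (ℝ × ℝ) →L[ℝ] ℝ × ℝ) (s, 0) := by
  have hstrict := (contDiff_normalMap hX hY).contDiffAt.hasStrictFDerivAt (x := (s, 0))
    one_ne_zero
  have hX1 : HasDerivAt X (deriv X s) s := (hX.differentiable two_ne_zero s).hasDerivAt
  have hY1 : HasDerivAt Y (deriv Y s) s := (hY.differentiable two_ne_zero s).hasDerivAt
  have hX2 : HasDerivAt (deriv X) (deriv (deriv X) s) s :=
    ((hX.iterate_deriv' 1 1).differentiable one_ne_zero s).hasDerivAt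
  have hY2 : HasDerivAt (deriv Y) (deriv (deriv Y) s) s :=
    ((hY.iterate_deriv' 1 1).differentiable one_ne_zero s).hasDerivAt
  have hfst : HasFDerivAt (fun p : ℝ × ℝ => p.1) (ContinuousLinearMap.fst ℝ ℝ ℝ) (s, (0 : ℝ)) :=
    hasFDerivAt_fst
  have hsnd : HasFDerivAt (fun p : ℝ × ℝ => p.2) (ContinuousLinearMap.snd ℝ ℝ ℝ) (s, (0 : ℝ)) :=
    hasFDerivAt_snd
  have hX1' := HasDerivAt.comp_hasFDerivAt (h₂ := X) (s, (0 : ℝ)) hX1 hfst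
  have hY1' := HasDerivAt.comp_hasFDerivAt (h₂ := Y) (s, (0 : ℝ)) hY1 hfst
  have hX2' := HasDerivAt.comp_hasFDerivAt (h₂ := deriv X) (s, (0 : ℝ)) hX2 hfst
  have hY2' := HasDerivAt.comp_hasFDerivAt (h₂ := deriv Y) (s, (0 : ℝ)) hY2 hfst
  have hd : HasFDerivAt (normalMap X Y) _ (s, 0) :=
    (hX1'.sub (hsnd.mul hY2')).prodMk (hY1'.add (hsnd.mul hX2'))
  have happ : ∀ q, fderiv ℝ (normalMap X Y) (s, 0) q =
      (deriv X s * q.1 - deriv Y s * q.2, deriv Y s * q.1 + deriv X s * q.2) := by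
    intro q
    rw [hd.fderiv]
    simp
  have hinj : Function.Injective
      (fderiv ℝ (normalMap X Y) (s, 0) : (ℝ × ℝ) →ₗ[ℝ] ℝ × ℝ) := by
    rw [← LinearMap.ker_eq_bot, LinearMap.ker_eq_bot']
    intro q hq
    rw [ContinuousLinearMap.coe_coe, happ, Prod.mk_eq_zero] at hq
    obtain ⟨h1, h2⟩ := hq
    refine Prod.ext ((mul_eq_zero.1 ?_).resolve_left hreg) ((mul_eq_zero.1 ?_).resolve_left hreg)
    · linear_combination deriv X s * h1 + deriv Y s * h2
    · linear_combination deriv X s * h2 - deriv Y s * h1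
  exact ⟨(LinearEquiv.ofInjectiveEndo _ hinj).toContinuousLinearEquiv,
    hstrict.congr_fderiv (ContinuousLinearMap.ext fun q => rfl)⟩

/-- Near a point of a properly embedded regular curve, the normal coordinates with `t ≠ 0` stay
off the curve. -/
theorem eventually_normalMap_notMem_range {X Y : ℝ → ℝ} (hX : ContDiff ℝ 2 X)
    (hY : ContDiff ℝ 2 Y) (hemb : Topology.IsClosedEmbedding fun s => (X s, Y s)) {s₀ : ℝ}
    (hreg : deriv X s₀ ^ 2 + deriv Y s₀ ^ 2 ≠ 0) :
    ∀ᶠ p : ℝ × ℝ in nhds (s₀, 0), p.2 ≠ 0 → normalMap X Y p ∉ range fun s => (X s, Y s) := by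
  obtain ⟨e, he⟩ := exists_equiv_hasStrictFDerivAt_normalMap hX hY hreg
  set Φ := he.toOpenPartialHomeomorph with hΦ
  have hsrc : Φ.source ∈ nhds (s₀, (0 : ℝ)) :=
    Φ.open_source.mem_nhds he.mem_toOpenPartialHomeomorph_source
  have hcurve : ∀ᶠ s in nhds s₀, ((s, 0) : ℝ × ℝ) ∈ Φ.source :=
    (Continuous.continuousAt (by fun_prop : Continuous fun s : ℝ => (s, (0 : ℝ)))).eventually hsrc
  rw [hemb.isInducing.nhds_eq_comap, eventually_comap] at hcurve
  have hcont : ContinuousAt (normalMap X Y) (s₀, 0) := he.continuousAt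
  have h0 : normalMap X Y (s₀, 0) = (X s₀, Y s₀) := by simp [normalMap]
  rw [← h0] at hcurve
  filter_upwards [hcont.eventually hcurve, hsrc] with p hp hps hp2
  rintro ⟨σ, hσ⟩
  have h1 : ((σ, 0) : ℝ × ℝ) = p := Φ.injOn (hp σ hσ) hps (by
    change normalMap X Y (σ, 0) = normalMap X Y p
    rw [← hσ]; simp [normalMap])
  exact hp2 (by rw [← h1])

namespace GenSolitaryFlow

variable {g Patm d : ℝ}

theorem isClosedEmbedding (F : GenSolitaryFlow g Patm d) :
    Topology.IsClosedEmbedding fun s => (F.X s, F.Y s) := by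
  have hc : Continuous fun s => (F.X s, F.Y s) :=
    F.X_smooth.continuous.prodMk F.Y_smooth.continuous
  have hX : Tendsto F.X (cocompact ℝ) (cocompact ℝ) := by
    rw [cocompact_eq_atBot_atTop]
    exact F.X_proper_bot.sup_sup F.X_proper_top
  have hp : IsProperMap fun s => (F.X s, F.Y s) :=
    isProperMap_iff_tendsto_cocompact.2
      ⟨hc, (Tendsto.of_tendsto_comp (g := Prod.fst) hX (comap_cocompact_le continuous_fst))⟩
  exact .of_continuous_injective_isClosedMap hc F.S_simple hp.isClosedMap

theorem mem_frontier_iff (F : GenSolitaryFlow g Patm d) (p : ℝ × ℝ) :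
    p ∈ frontier F.Ω ↔ p ∈ (range fun s => (F.X s, F.Y s)) ∨ p.2 = -d := by
  rw [F.Ω_frontier]; rfl

theorem mem_closure (F : GenSolitaryFlow g Patm d) (s : ℝ) : (F.X s, F.Y s) ∈ closure F.Ω :=
  frontier_subset_closure ((F.mem_frontier_iff _).2 (.inl ⟨s, rfl⟩))

theorem notMem (F : GenSolitaryFlow g Patm d) (s : ℝ) : (F.X s, F.Y s) ∉ F.Ω := by
  have h := (F.mem_frontier_iff _).2 (.inl ⟨s, rfl⟩)
  rw [F.Ω_open.frontier_eq] at h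
  exact h.2

theorem exists_box (F : GenSolitaryFlow g Patm d) (s₀ : ℝ) :
    ∃ ε > 0, ∀ s t, |s - s₀| < ε → |t| < ε → t ≠ 0 →
      normalMap F.X F.Y (s, t) ∉ frontier F.Ω := by
  have h1 := eventually_normalMap_notMem_range F.X_smooth F.Y_smooth F.isClosedEmbedding
    (F.regular s₀)
  have hc : Continuous fun p => (normalMap F.X F.Y p).2 :=
    (contDiff_normalMap F.X_smooth F.Y_smooth).continuous.snd
  have h2 : ∀ᶠ p in nhds (s₀, (0 : ℝ)), -d < (normalMap F.X F.Y p).2 :=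
    hc.continuousAt.eventually_const_lt (by simpa [normalMap] using F.S_above_bed s₀)
  obtain ⟨ε, hε, h⟩ := Metric.eventually_nhds_iff.1 (h1.and h2)
  refine ⟨ε, hε, fun s t hs ht ht0 hmem => ?_⟩
  have hst : dist (s, t) (s₀, 0) < ε := by
    rw [Prod.dist_eq, max_lt_iff]
    simpa [Real.dist_eq] using ⟨hs, ht⟩
  rcases (F.mem_frontier_iff _).1 hmem with hm | hm
  · exact (h hst).1 ht0 hm
  · exact (h hst).2.ne' hm

/-- Locally, each side of the surface is either contained in the fluid or disjoint from its
closure. -/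
theorem exists_sides (F : GenSolitaryFlow g Patm d) (s₀ : ℝ) :
    ∃ ε > 0,
      ((∀ s t, |s - s₀| < ε → t ∈ Ioo 0 ε → normalMap F.X F.Y (s, t) ∈ F.Ω) ∨
        (∀ s t, |s - s₀| < ε → t ∈ Ioo 0 ε → normalMap F.X F.Y (s, t) ∉ closure F.Ω)) ∧
      ((∀ s t, |s - s₀| < ε → t ∈ Ioo (-ε) 0 → normalMap F.X F.Y (s, t) ∈ F.Ω) ∨
        (∀ s t, |s - s₀| < ε → t ∈ Ioo (-ε) 0 → normalMap F.X F.Y (s, t) ∉ closure F.Ω)) := by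
  obtain ⟨ε, hε, h⟩ := F.exists_box s₀
  have key : ∀ T : Set ℝ, Convex ℝ T → (∀ t ∈ T, |t| < ε ∧ t ≠ 0) →
      (∀ s t, |s - s₀| < ε → t ∈ T → normalMap F.X F.Y (s, t) ∈ F.Ω) ∨
        (∀ s t, |s - s₀| < ε → t ∈ T → normalMap F.X F.Y (s, t) ∉ closure F.Ω) := by
    intro T hT hT'
    have hpre : IsPreconnected (normalMap F.X F.Y '' (Metric.ball s₀ ε ×ˢ T)) :=
      ((convex_ball s₀ ε).prod hT).isPreconnected.image _
        (contDiff_normalMap F.X_smooth F.Y_smooth).continuous.continuousOn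
    have hmem : ∀ s t, |s - s₀| < ε → t ∈ T →
        normalMap F.X F.Y (s, t) ∈ normalMap F.X F.Y '' (Metric.ball s₀ ε ×ˢ T) :=
      fun s t hs ht => ⟨(s, t), ⟨by simpa [Real.dist_eq] using hs, ht⟩, rfl⟩
    refine (hpre.subset_or_subset_compl_closure F.Ω_open ?_).imp
      (fun hsub s t hs ht => hsub (hmem s t hs ht)) (fun hsub s t hs ht => hsub (hmem s t hs ht))
    rintro _ ⟨⟨s, t⟩, ⟨hs, ht⟩, rfl⟩
    exact h s t (by simpa [Real.dist_eq] using hs) (hT' t ht).1 (hT' t ht).2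
  refine ⟨ε, hε, key _ (convex_Ioo _ _) fun t ht => ⟨?_, ht.1.ne'⟩,
    key _ (convex_Ioo _ _) fun t ht => ⟨?_, ht.2.ne⟩⟩
  · rw [abs_of_pos ht.1]; exact ht.2
  · rw [abs_of_neg ht.2]; linarith [ht.1]

/-- Far out, the surface is nowhere vertical. -/
theorem exists_deriv_eq (F : GenSolitaryFlow g Patm d) :
    ∃ R, ∀ s, R < |F.X s| → F.Y s = F.η (F.X s) ∧
      deriv F.Y s = deriv F.η (F.X s) * deriv F.X s ∧ deriv F.X s ≠ 0 := by
  obtain ⟨R, hR⟩ := F.graph_outside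
  refine ⟨R, fun s hs => ?_⟩
  have hev : F.Y =ᶠ[nhds s] fun t => F.η (F.X t) := by
    have : ∀ᶠ t in nhds s, R < |F.X t| :=
      F.X_smooth.continuous.abs.continuousAt.eventually_const_lt hs
    exact this.mono fun t ht => hR t ht.le
  have hd : deriv F.Y s = deriv F.η (F.X s) * deriv F.X s := by
    rw [hev.deriv_eq]
    exact deriv_comp s (F.η_smooth.differentiable two_ne_zero _)
      (F.X_smooth.differentiable two_ne_zero _)
  refine ⟨hR s hs.le, hd, fun h0 => F.regular s ?_⟩
  rw [hd, h0]; ring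

/-- The fluid does not fill the region above the surface far to the left. -/
theorem exists_left_side_notMem (hg : 0 < g) (F : GenSolitaryFlow g Patm d) :
    ∃ s, ¬ ∃ ε > 0, ∀ t ∈ Ioo 0 ε, normalMap F.X F.Y (s, t) ∈ F.Ω := by
  obtain ⟨R₁, hR₁⟩ := F.exists_deriv_eq
  obtain ⟨R₂, hR₂⟩ := F.P_asymptotic 1 one_pos
  obtain ⟨C, hC⟩ := F.P_bounded
  set R := max (max R₁ R₂) 0
  have hRR : R₁ ≤ R ∧ R₂ ≤ R ∧ 0 ≤ R :=
    ⟨(le_max_left _ _).trans (le_max_left _ _), (le_max_right _ _).trans (le_max_left _ _),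
      le_max_right _ _⟩
  have habs : ∀ x, x < -R → R < |x| := fun x hx => lt_abs.2 (.inr (by linarith))
  obtain ⟨a, -, haR, ha⟩ := exists_last_time F.X_smooth.continuous F.X_proper_top F.X_proper_bot
    0 (-R)
  obtain ⟨hYa, hY'a, hX'a⟩ := hR₁ a (hRR.1.trans_lt (habs _ haR))
  have hXd := F.X_smooth.differentiable two_ne_zero a
  have hX'pos : 0 < deriv F.X a := (deriv_nonneg_of_forall_gt hXd ha).lt_of_ne' hX'a
  refine ⟨a, fun ⟨ε, hε, hmem⟩ => ?_⟩
  let U : Set (ℝ × ℝ) := {p | p.1 < -R ∧ F.η p.1 < p.2}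
  have hUpre : IsPreconnected U := by
    have : U = (fun q : ℝ × ℝ => (q.1, F.η q.1 + q.2)) '' (Iio (-R) ×ˢ Ioi 0) := by
      ext ⟨x, y⟩
      constructor
      · rintro ⟨h1, h2⟩
        exact ⟨(x, y - F.η x), ⟨h1, sub_pos.2 h2⟩, by simp⟩
      · rintro ⟨⟨x', h⟩, ⟨h1, h2⟩, heq⟩
        simp only [Prod.mk.injEq] at heq
        obtain ⟨rfl, rfl⟩ := heq
        exact ⟨h1, lt_add_of_pos_right _ h2⟩
    rw [this]
    have := F.η_smooth.continuous
    exact ((convex_Iio _).prod (convex_Ioi _)).isPreconnected.image _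
      (Continuous.continuousOn (by fun_prop))
  have hUfr : ∀ p ∈ U, p ∉ frontier F.Ω := by
    rintro p ⟨h1, h2⟩ hp
    rcases (F.mem_frontier_iff p).1 hp with ⟨s, rfl⟩ | hp
    · exact h2.ne' (hR₁ s (hRR.1.trans_lt (habs _ h1))).1
    · obtain ⟨s, hs⟩ := F.X_smooth.continuous.surjective F.X_proper_top F.X_proper_bot p.1
      rw [← hs] at h1 h2
      have h3 := (hR₁ s (hRR.1.trans_lt (habs _ h1))).1
      have h4 := F.S_above_bed s
      linarith
  have hdη : HasDerivAt F.η (deriv F.η (F.X a)) (F.X a - 0 * deriv F.Y a) := by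
    simpa using (F.η_smooth.differentiable two_ne_zero (F.X a)).hasDerivAt
  have hlin : HasDerivAt (fun t => F.X a - t * deriv F.Y a) (-deriv F.Y a) 0 := by
    simpa using ((hasDerivAt_id (0 : ℝ)).mul_const (deriv F.Y a)).const_sub (F.X a)
  have hlin' : HasDerivAt (fun t => F.Y a + t * deriv F.X a) (deriv F.X a) 0 := by
    simpa using ((hasDerivAt_id (0 : ℝ)).mul_const (deriv F.X a)).const_add (F.Y a)
  have hder := hlin'.sub (hdη.comp 0 hlin)
  have hpos : 0 < deriv F.X a - deriv F.η (F.X a) * -deriv F.Y a := by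
    rw [hY'a]
    have : 0 ≤ deriv F.η (F.X a) ^ 2 * deriv F.X a := by positivity
    nlinarith
  have hUev : ∀ᶠ t in nhdsWithin (0 : ℝ) (Ioi 0), normalMap F.X F.Y (a, t) ∈ U := by
    have h1 : ∀ᶠ t in nhdsWithin (0 : ℝ) (Ioi 0), F.X a - t * deriv F.Y a < -R :=
      (hlin.continuousAt.eventually_lt_const (by simpa using haR)).filter_mono
        nhdsWithin_le_nhds
    have h2 := (hasDerivAt_iff_tendsto_slope.1 hder).mono_left
      (nhdsWithin_mono (0 : ℝ) (show Ioi 0 ⊆ {(0 : ℝ)}ᶜ from fun t ht => ht.ne'))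
    filter_upwards [h1, h2.eventually_const_lt hpos, self_mem_nhdsWithin] with t ht1 ht2 ht
    refine ⟨ht1, ?_⟩
    rw [slope_def_field] at ht2
    have h3 := (div_pos_iff_of_pos_right (sub_pos.2 ht)).1 ht2
    simp [hYa] at h3
    simp [normalMap]
    linarith
  have hUΩ : U ⊆ F.Ω := by
    obtain ⟨t, htU, ht⟩ := (hUev.and (Ioo_mem_nhdsGT hε)).exists
    refine (hUpre.subset_or_subset_compl_closure F.Ω_open hUfr).resolve_right fun h => ?_
    exact h htU (subset_closure (hmem t ht))
  set y := max (F.η (F.X a) + 1) ((C + |Patm| + 2) / g) with hy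
  have hp : (F.X a, y) ∈ closure F.Ω :=
    subset_closure (hUΩ ⟨haR, (lt_add_one _).trans_le (le_max_left _ _)⟩)
  have h1 := abs_lt.1 (hR₂ _ hp (hRR.2.1.trans (habs _ haR).le))
  have h2 := abs_le.1 (hC _ hp)
  have h3 : C + |Patm| + 2 ≤ y * g := (div_le_iff₀ hg).1 (le_max_right _ _)
  have h4 := le_abs_self Patm
  simp only at h1
  linarith [h1.2]

/-- The vector `(-Y', X')` points out of the fluid along the whole surface. -/
theorem exists_left_side_notMem_closure (hg : 0 < g) (F : GenSolitaryFlow g Patm d) (s₀ : ℝ) :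
    ∃ ε > 0, ∀ s t, |s - s₀| < ε → t ∈ Ioo 0 ε → normalMap F.X F.Y (s, t) ∉ closure F.Ω := by
  let A : Set ℝ := {s | ∃ ε > 0, ∀ t ∈ Ioo 0 ε, normalMap F.X F.Y (s, t) ∈ F.Ω}
  have hout : ∀ s, (∃ ε > 0, ∀ t ∈ Ioo 0 ε, normalMap F.X F.Y (s, t) ∉ closure F.Ω) → s ∉ A := by
    rintro s ⟨ε, hε, h⟩ ⟨ε', hε', h'⟩
    obtain ⟨t, ht1, ht2⟩ := exists_between (lt_min hε hε')
    rw [lt_min_iff] at ht2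
    exact h t ⟨ht1, ht2.1⟩ (subset_closure (h' t ⟨ht1, ht2.2⟩))
  have hnhds : ∀ s, ∃ ε > 0, (∀ s', |s' - s| < ε → s' ∈ A) ∨ ((∀ s', |s' - s| < ε → s' ∉ A) ∧
      ∀ s' t, |s' - s| < ε → t ∈ Ioo 0 ε → normalMap F.X F.Y (s', t) ∉ closure F.Ω) := by
    intro s
    obtain ⟨ε, hε, h | h, -⟩ := F.exists_sides s
    · exact ⟨ε, hε, .inl fun s' hs' => ⟨ε, hε, fun t ht => h s' t hs' ht⟩⟩
    · exact ⟨ε, hε, .inr ⟨fun s' hs' => hout s' ⟨ε, hε, fun t ht => h s' t hs' ht⟩, h⟩⟩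
  have hclopen : IsClopen A := by
    refine ⟨⟨Metric.isOpen_iff.2 fun s hs => ?_⟩, Metric.isOpen_iff.2 fun s hs => ?_⟩ <;>
    obtain ⟨ε, hε, h | h⟩ := hnhds s
    · exact absurd (h s (by simpa using hε)) hs
    · exact ⟨ε, hε, fun s' hs' => h.1 s' hs'⟩
    · exact ⟨ε, hε, fun s' hs' => h s' hs'⟩
    · exact absurd hs (h.1 s (by simpa using hε))
  have hA : A = ∅ := by
    refine (isClopen_iff.1 hclopen).resolve_right fun h => ?_
    obtain ⟨s, hs⟩ := F.exists_left_side_notMem hg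
    exact hs (h ▸ mem_univ s : s ∈ A)
  obtain ⟨ε, hε, h | h⟩ := hnhds s₀
  · have : s₀ ∈ A := h s₀ (by simpa using hε)
    simp [hA] at this
  · exact ⟨ε, hε, h.2⟩

/-- The vector `(Y', -X')` points into the fluid along the whole surface. -/
theorem exists_right_side_mem (hg : 0 < g) (F : GenSolitaryFlow g Patm d) (s₀ : ℝ) :
    ∃ ε > 0, ∀ t ∈ Ioo (-ε) 0, normalMap F.X F.Y (s₀, t) ∈ F.Ω := by
  obtain ⟨ε₁, hε₁, h₁⟩ := F.exists_left_side_notMem_closure hg s₀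
  obtain ⟨ε₂, hε₂, -, h₂ | h₂⟩ := F.exists_sides s₀
  · exact ⟨ε₂, hε₂, fun t ht => h₂ s₀ t (by simpa using hε₂) ht⟩
  exfalso
  obtain ⟨e, he⟩ := exists_equiv_hasStrictFDerivAt_normalMap F.X_smooth F.Y_smooth (F.regular s₀)
  have hmap := he.map_nhds_eq_of_equiv
  have h0 : normalMap F.X F.Y (s₀, 0) = (F.X s₀, F.Y s₀) := by simp [normalMap]
  rw [h0] at hmap
  have hball : normalMap F.X F.Y '' Metric.ball (s₀, 0) (min ε₁ ε₂) ∈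
      nhds (F.X s₀, F.Y s₀) := by
    rw [← hmap]
    exact image_mem_map (Metric.ball_mem_nhds _ (lt_min hε₁ hε₂))
  obtain ⟨_, ⟨⟨s, t⟩, hst, rfl⟩, hΩ⟩ := mem_closure_iff_nhds.1 (F.mem_closure s₀) _ hball
  rw [Metric.mem_ball, Prod.dist_eq, max_lt_iff, Real.dist_eq, Real.dist_eq, lt_min_iff,
    lt_min_iff, sub_zero] at hst
  rcases lt_trichotomy t 0 with ht | rfl | ht
  · exact h₂ s t hst.1.2 ⟨(abs_lt.1 hst.2.2).1, ht⟩ (subset_closure hΩ)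
  · exact F.notMem s (by simpa [normalMap] using hΩ)
  · exact h₁ s t hst.1.1 ⟨ht, (abs_lt.1 hst.2.1).2⟩ (subset_closure hΩ)

theorem isOutwardNormalAt (hg : 0 < g) (F : GenSolitaryFlow g Patm d) (s : ℝ) :
    F.IsOutwardNormalAt (-deriv F.Y s, deriv F.X s) s := by
  obtain ⟨ε, hε, h⟩ := F.exists_left_side_notMem_closure hg s
  refine ⟨by ring, ε, hε, fun t ht htε => ?_⟩
  have := h s t (by simpa using hε) ⟨ht, htε⟩
  simpa [normalMap, sub_eq_add_neg] using this

/-- The Euler equations hold up to the surface. -/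
theorem euler_of_mem_closure (F : GenSolitaryFlow g Patm d) {p : ℝ × ℝ} (hp : p ∈ closure F.Ω) :
    F.u p * pdX F.u p + F.v p * pdY F.u p = -pdX F.P p ∧
      F.u p * pdX F.v p + F.v p * pdY F.v p = -(pdY F.P p) - g := by
  have hcu := F.u_smooth.continuous
  have hcv := F.v_smooth.continuous
  have hu := F.u_smooth.continuous_fderiv one_ne_zero
  have hv := F.v_smooth.continuous_fderiv one_ne_zero
  have hP := F.P_smooth.continuous_fderiv two_ne_zero
  unfold pdX pdY
  have hcl : IsClosed {p | F.u p * fderiv ℝ F.u p (1, 0) + F.v p * fderiv ℝ F.u p (0, 1) =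
        -fderiv ℝ F.P p (1, 0) ∧
      F.u p * fderiv ℝ F.v p (1, 0) + F.v p * fderiv ℝ F.v p (0, 1) =
        -fderiv ℝ F.P p (0, 1) - g} :=
    (isClosed_eq (by fun_prop) (by fun_prop)).and (isClosed_eq (by fun_prop) (by fun_prop))
  exact hcl.closure_subset_iff.2 (fun q hq => ⟨F.euler_x q hq, F.euler_y q hq⟩) hp

theorem fderiv_apply_eq (f : ℝ × ℝ → ℝ) (p : ℝ × ℝ) (a b : ℝ) :
    fderiv ℝ f p (a, b) = a * pdX f p + b * pdY f p := by
  rw [show ((a, b) : ℝ × ℝ) = a • (1, 0) + b • (0, 1) by simp]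
  simp only [map_add, map_smul, smul_eq_mul, pdX, pdY]

/-- The normal component of the Euler equations along the surface: curvature, gravity and the
normal pressure gradient balance. -/
theorem normal_balance (F : GenSolitaryFlow g Patm d) {s : ℝ} {l : ℝ}
    (hu : F.u (F.X s, F.Y s) = l * deriv F.X s) (hv : F.v (F.X s, F.Y s) = l * deriv F.Y s) :
    l ^ 2 * (deriv F.X s * deriv (deriv F.Y) s - deriv F.Y s * deriv (deriv F.X) s) =
      -fderiv ℝ F.P (F.X s, F.Y s) (-deriv F.Y s, deriv F.X s) - g * deriv F.X s := by
  have hX1 := (F.X_smooth.differentiable two_ne_zero s).hasDerivAt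
  have hY1 := (F.Y_smooth.differentiable two_ne_zero s).hasDerivAt
  have hX2 := ((F.X_smooth.iterate_deriv' 1 1).differentiable one_ne_zero s).hasDerivAt
  have hY2 := ((F.Y_smooth.iterate_deriv' 1 1).differentiable one_ne_zero s).hasDerivAt
  have hγ := hX1.prodMk hY1
  have hU : HasDerivAt (fun s => F.u (F.X s, F.Y s)) _ s :=
    (F.u_smooth.differentiable one_ne_zero (F.X s, F.Y s)).hasFDerivAt.comp_hasDerivAt s hγ
  have hV : HasDerivAt (fun s => F.v (F.X s, F.Y s)) _ s :=
    (F.v_smooth.differentiable one_ne_zero (F.X s, F.Y s)).hasFDerivAt.comp_hasDerivAt s hγ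
  have hL := hU.mul hY2
  have hR := hV.mul hX2
  have heq : (fun s => F.u (F.X s, F.Y s)) * deriv F.Y =
      (fun s => F.v (F.X s, F.Y s)) * deriv F.X := funext F.surface_tangency
  have h := hL.unique (heq ▸ hR)
  obtain ⟨hE1, hE2⟩ := F.euler_of_mem_closure (F.mem_closure s)
  simp only [fderiv_apply_eq, Function.iterate_one] at h ⊢
  rw [hu, hv] at h hE1 hE2
  linear_combination l * h - deriv F.Y s * hE1 + deriv F.X s * hE2

/-- If the flow does not stagnate on the surface, the velocity there is a nonvanishing multiple of
the tangent vector, of constant sign. -/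
theorem exists_velocity_factor (F : GenSolitaryFlow g Patm d)
    (hS : ∀ s, 0 < F.u (F.X s, F.Y s) ^ 2 + F.v (F.X s, F.Y s) ^ 2) :
    ∃ l : ℝ → ℝ, (∀ s, F.u (F.X s, F.Y s) = l s * deriv F.X s) ∧
      (∀ s, F.v (F.X s, F.Y s) = l s * deriv F.Y s) ∧ ((∀ s, 0 < l s) ∨ ∀ s, l s < 0) := by
  let l : ℝ → ℝ := fun s => (F.u (F.X s, F.Y s) * deriv F.X s + F.v (F.X s, F.Y s) * deriv F.Y s) /
    (deriv F.X s ^ 2 + deriv F.Y s ^ 2)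
  have hu : ∀ s, F.u (F.X s, F.Y s) = l s * deriv F.X s := fun s => by
    have h := F.surface_tangency s
    simp only [l]
    rw [div_mul_eq_mul_div, eq_div_iff (F.regular s)]
    linear_combination deriv F.Y s * h
  have hv : ∀ s, F.v (F.X s, F.Y s) = l s * deriv F.Y s := fun s => by
    have h := F.surface_tangency s
    simp only [l]
    rw [div_mul_eq_mul_div, eq_div_iff (F.regular s)]
    linear_combination -deriv F.X s * h
  have hl0 : ∀ s, l s ≠ 0 := fun s h => by
    have := hS s
    rw [hu, hv, h] at this
    norm_num at this
  have hlc : Continuous l := by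
    have h1 := F.u_smooth.continuous
    have h2 := F.v_smooth.continuous
    have h3 := F.X_smooth.continuous
    have h4 := F.Y_smooth.continuous
    have h5 := F.X_smooth.continuous_deriv one_le_two
    have h6 := F.Y_smooth.continuous_deriv one_le_two
    exact Continuous.div (by fun_prop) (by fun_prop) F.regular
  refine ⟨l, hu, hv, ?_⟩
  by_contra! h
  obtain ⟨⟨s, hs⟩, t, ht⟩ := h
  obtain ⟨r, hr⟩ := mem_range_of_exists_le_of_exists_ge hlc ⟨s, hs⟩ ⟨t, ht⟩
  exact hl0 r hr

/-- If the surface runs backwards somewhere, then it fails to turn counterclockwise at some point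
where it runs backwards. -/
theorem exists_clockwise_turning (F : GenSolitaryFlow g Patm d) {s : ℝ} (hs : deriv F.X s < 0) :
    ∃ σ, deriv F.X σ < 0 ∧
      deriv F.X σ * deriv (deriv F.Y) σ - deriv F.Y σ * deriv (deriv F.X) σ ≤ 0 := by
  obtain ⟨R, hR⟩ := F.exists_deriv_eq
  have hXd := F.X_smooth.differentiable two_ne_zero
  obtain ⟨a, has, haR, ha⟩ := exists_last_time F.X_smooth.continuous F.X_proper_top F.X_proper_bot
    s (-R)
  obtain ⟨b, hsb, hbR, hb⟩ := exists_first_time F.X_smooth.continuous F.X_proper_top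
    F.X_proper_bot s R
  have ha' := (deriv_nonneg_of_forall_gt (hXd a) ha).lt_of_ne'
    (hR a (lt_abs.2 (.inr (by linarith)))).2.2
  have hb' := (deriv_nonneg_of_forall_lt (hXd b) hb).lt_of_ne' (hR b (lt_abs.2 (.inl hbR))).2.2
  by_contra! h
  exact hs.not_ge (deriv_nonneg_of_turning F.X_smooth F.Y_smooth F.regular F.S_simple ha hb ha' hb'
    h has.le hsb.le)

/-- Where the outward normal derivative of the pressure is positive, the fluid just below the
surface has lower pressure. -/
theorem exists_pressure_lt (hg : 0 < g) (F : GenSolitaryFlow g Patm d) {s : ℝ}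
    (hs : 0 < fderiv ℝ F.P (F.X s, F.Y s) (-deriv F.Y s, deriv F.X s)) :
    ∃ p ∈ closure F.Ω, F.P p < Patm := by
  obtain ⟨ε, hε, h⟩ := F.exists_right_side_mem hg s
  have hlin : HasDerivAt (fun t => normalMap F.X F.Y (s, t)) (-deriv F.Y s, deriv F.X s) 0 := by
    have h1 := ((hasDerivAt_id (0 : ℝ)).mul_const (deriv F.Y s)).const_sub (F.X s)
    have h2 := ((hasDerivAt_id (0 : ℝ)).mul_const (deriv F.X s)).const_add (F.Y s)
    simpa [normalMap] using! h1.prodMk h2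
  have h0 : normalMap F.X F.Y (s, 0) = (F.X s, F.Y s) := by simp [normalMap]
  have hP : HasFDerivAt F.P (fderiv ℝ F.P (F.X s, F.Y s)) (normalMap F.X F.Y (s, 0)) := by
    rw [h0]; exact (F.P_smooth.differentiable two_ne_zero _).hasFDerivAt
  have hd : HasDerivAt (fun t => F.P (normalMap F.X F.Y (s, t))) _ 0 :=
    hP.comp_hasDerivAt (0 : ℝ) hlin
  have h2 := (hasDerivAt_iff_tendsto_slope.1 hd).mono_left
    (nhdsWithin_mono (0 : ℝ) (show Iio 0 ⊆ {(0 : ℝ)}ᶜ from fun t ht => ht.ne))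
  obtain ⟨t, ht1, ht2⟩ := ((h2.eventually_const_lt hs).and
    (Ioo_mem_nhdsLT (neg_lt_zero.2 hε))).exists
  refine ⟨_, subset_closure (h t ht2), ?_⟩
  rw [slope_def_field, h0, F.surface_pressure] at ht1
  by_contra! hle
  exact ht1.not_ge (div_nonpos_of_nonneg_of_nonpos (sub_nonneg.2 hle) (sub_nonpos.2 ht2.2.le))

end GenSolitaryFlow

/-- **Overturning solitary waves must have a pressure sink.**  Suppose `u² + v² ≥ δ > 0`
on the free surface `S`.  If the wave overturns, i.e. `u` takes both strictly positive
and strictly negative values along `S`, then there is a point of `S` where the outward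
normal derivative of `P` is strictly positive; in particular `P` does not attain its
minimum over the closure of `Ω` on the free surface. -/
theorem overturning_solitary_pressure_sink (g Patm d : ℝ) (hg : 0 < g) (hd : 0 < d)
    (F : GenSolitaryFlow g Patm d)
    (δ : ℝ) (hδ : 0 < δ)
    (hS : ∀ s, δ ≤ F.u (F.X s, F.Y s) ^ 2 + F.v (F.X s, F.Y s) ^ 2)
    (hover_pos : ∃ s, 0 < F.u (F.X s, F.Y s))
    (hover_neg : ∃ s, F.u (F.X s, F.Y s) < 0) :
    (∃ s, ∃ n : ℝ × ℝ, F.IsOutwardNormalAt n s ∧ 0 < fderiv ℝ F.P (F.X s, F.Y s) n) ∧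
    (∀ s, ∃ p ∈ closure F.Ω, F.P p < F.P (F.X s, F.Y s)) := by
  obtain ⟨l, hu, hv, hl⟩ := F.exists_velocity_factor fun s => hδ.trans_le (hS s)
  obtain ⟨s₀, hs₀⟩ : ∃ s, deriv F.X s < 0 := by
    obtain ⟨s, hs⟩ := hover_pos
    obtain ⟨t, ht⟩ := hover_neg
    rw [hu] at hs ht
    rcases hl with hl | hl
    · exact ⟨t, neg_of_mul_neg_right ht (hl t).le⟩
    · exact ⟨s, neg_of_mul_pos_right hs (hl s).le⟩
  obtain ⟨s, hs, hturn⟩ := F.exists_clockwise_turning hs₀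
  have hpos : 0 < fderiv ℝ F.P (F.X s, F.Y s) (-deriv F.Y s, deriv F.X s) := by
    have h1 := F.normal_balance (hu s) (hv s)
    have h2 := mul_nonpos_of_nonneg_of_nonpos (sq_nonneg (l s)) hturn
    have h3 := mul_neg_of_pos_of_neg hg hs
    linarith
  refine ⟨⟨s, _, F.isOutwardNormalAt hg s, hpos⟩, fun t => ?_⟩
  rw [F.surface_pressure]
  exact F.exists_pressure_lt hg hpos
end
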